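/- Let m, n be positive integers with m ≥ 2 and let G = C_m ⊕ C_{mn}. Assume that C_m ⊕ C_m has Property C, i.e., every sequence over C_m ⊕ C_m of length 3m − 3 with no short zero-sum subsequence equals T^{m−1} for some sequence T (of length 3). Then every sequence S over G of length 2m + mn − 3 (which equals η(G) − 1) with no short zero-sum subsequence is of one of the following two forms: (a) S = e_1^{m-1} · e_2^{sm-1} · (−x·e_1 + e_2)^{(n+1−s)m−1} for some basis {e_1, e_2} of G with ord(e_2) = mn, some integer x with gcd(x, m) = 1, and some s ∈ [1, n]; or (b) S = g_1^{m-1} · g_2^{mn-1} · (−g_1 + g_2)^{m-1} for some generating set {g_1, g_2} of G with ord(g_2) = mn. -/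

import Mathlib

/-- If `⌊kβ/m⌋ = ⌊kc/m⌋ + ⌊kd/m⌋` for all `1 ≤ k < m`, where `β + 1 = c + d`, then `d < 2`. -/
lemma floor_split_false {m β c d : ℕ} (hβ : β + 1 = c + d) (hd : 2 ≤ d) (hdc : d ≤ c)
    (h2 : 2 * β < m) (hcm : ¬ c ∣ m)
    (hfl : ∀ k, 1 ≤ k → k < m → k * β / m = k * c / m + k * d / m) : False := by
  have hm : 0 < m := by omega
  have ceil_spec : ∀ y e : ℕ, 0 < e → 0 < y →
      ∃ k, k * e < y ∧ y ≤ (k + 1) * e := by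
    intro y e he hy
    refine ⟨(y - 1) / e, ?_, ?_⟩
    · have := Nat.div_mul_le_self (y - 1) e
      omega
    · have := Nat.lt_div_mul_add (a := y - 1) he
      rw [add_mul, one_mul]; omega
  obtain ⟨p, hp1, hp2⟩ := ceil_spec m c (by omega) hm
  obtain ⟨k, hk1, hk2⟩ := ceil_spec m d (by omega) hm
  have hkm : k + 1 < m := by nlinarith
  have hp3 : 2 ≤ p := by
    by_contra! h
    have : (p + 1) * c ≤ 2 * c := Nat.mul_le_mul_right _ (by omega)
    omega
  have hpk : p ≤ k := by
    by_contra! h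
    have : (k + 1) * c ≤ p * c := Nat.mul_le_mul_right _ (by omega)
    have : (k + 1) * d ≤ (k + 1) * c := Nat.mul_le_mul_left _ hdc
    omega
  have hpβ : p * β < m := by
    have := hfl p (by omega) (by omega)
    rw [Nat.div_eq_of_lt hp1, Nat.div_eq_of_lt
      (lt_of_le_of_lt (Nat.mul_le_mul_left p hdc) hp1)] at this
    exact Nat.lt_of_div_eq_zero hm this
  have gap : ∀ a b, b ≤ a → m < (a - b) * β → p < a - b := by
    intro a b _ h
    by_contra! h'
    have := Nat.mul_le_mul_right β h'
    omega
  obtain ⟨j, hj⟩ : ∃ j, j = (k + 1) * c / m := ⟨_, rfl⟩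
  have hkd : (k + 1) * d / m = 1 := by
    apply Nat.div_eq_of_lt_le <;> nlinarith
  have hk0 := hfl (k + 1) (by omega) hkm
  have hk0' := hfl k (by omega) (by omega)
  rw [hkd, ← hj] at hk0
  rw [Nat.div_eq_of_lt hk1, add_zero] at hk0'
  have e1 : (j + 1) * m ≤ (k + 1) * β := by
    rw [← hk0]; exact Nat.div_mul_le_self _ _
  have e2 : j * m ≤ k * c := by
    rw [← Nat.le_div_iff_mul_le hm, ← hk0', Nat.le_div_iff_mul_le hm]
    nlinarith
  have e3 : (k + 1) * c < (j + 1) * m := by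
    rw [← Nat.div_lt_iff_lt_mul hm]; omega
  have e4 : k * β < (j + 1) * m := by
    rw [← Nat.div_lt_iff_lt_mul hm, hk0', Nat.div_lt_iff_lt_mul hm]
    nlinarith
  have hj1 : 1 ≤ j := by
    rw [hj, Nat.le_div_iff_mul_le hm]
    nlinarith
  obtain ⟨l, hl1, hl2⟩ := ceil_spec (j * m) c (by omega) (by positivity)
  have hlk : l < k := by
    by_contra! h
    have := Nat.mul_le_mul_right c h
    omega
  have hl3 : 1 ≤ l := by
    by_contra! h
    have : l = 0 := by omega
    subst this
    nlinarith
  have hlβ : l * β < j * m := by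
    have := hfl l hl3 (by omega)
    rw [Nat.div_eq_of_lt (a := l * d) (lt_of_le_of_lt (Nat.mul_le_mul_right d hlk.le) hk1),
      add_zero] at this
    rw [← Nat.div_lt_iff_lt_mul hm, this, Nat.div_lt_iff_lt_mul hm]
    exact hl1
  have g1 : p < (k + 1) - l := by
    apply gap _ _ (by omega)
    rw [Nat.sub_mul]
    have : (j + 1) * m = j * m + m := by ring
    omega
  by_cases hlast : (j + 1) * m ≤ (m - 1) * c
  · obtain ⟨r, hr1, hr2⟩ := ceil_spec ((j + 1) * m) c (by omega) (by positivity)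
    have hrm : r + 1 < m := by
      by_contra! h
      have := Nat.mul_le_mul_right c (show m - 1 ≤ r by omega)
      omega
    have hkr : k + 1 < r + 1 := by
      by_contra! h
      have := Nat.mul_le_mul_right c h
      omega
    have f1 : (j + 2) * m ≤ (r + 1) * β := by
      rw [← Nat.le_div_iff_mul_le hm, hfl (r + 1) (by omega) hrm]
      have a1 : j + 1 ≤ (r + 1) * c / m := by rwa [Nat.le_div_iff_mul_le hm]
      have a2 : 1 ≤ (r + 1) * d / m := by
        exact hkd.symm.le.trans (Nat.div_le_div_right (Nat.mul_le_mul_right _ hkr.le))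
      omega
    have g2 : p < (r + 1) - k := by
      apply gap _ _ (by omega)
      rw [Nat.sub_mul]
      have : (j + 2) * m = (j + 1) * m + m := by ring
      omega
    have g3 : r ≤ l + p + 1 := by
      by_contra! h
      have h1 := Nat.mul_le_mul_right c (show (l + 1) + (p + 1) ≤ r by omega)
      have : (j + 1) * m = j * m + m := by ring
      have : ((l + 1) + (p + 1)) * c = (l + 1) * c + (p + 1) * c := by ring
      omega
    omega
  · have c1 : (m - 1) * c / m = c - 1 := by
      apply Nat.div_eq_of_lt_le
      · zify [show 1 ≤ m by omega, show 1 ≤ c by omega]; nlinarith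
      · zify [show 1 ≤ m by omega, show 1 ≤ c by omega]; nlinarith
    have hjc : c ≤ j + 1 := by
      have : (m - 1) * c / m < j + 1 := by
        rw [Nat.div_lt_iff_lt_mul hm]; omega
      omega
    have hjc' : j ≤ c - 1 := by
      rw [← c1, hj]
      exact Nat.div_le_div_right (Nat.mul_le_mul_right _ (by omega))
    have hjj : j + 1 = c := by omega
    subst hjj
    have hmk : m - k ≤ p := by
      by_contra! h
      have h1 := Nat.mul_le_mul_right (j + 1) h
      have h3 : (m - k) * (j + 1) + k * (j + 1) = m * (j + 1) := by
        rw [← add_mul]; congr 1; omega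
      have h4 : m * (j + 1) = j * m + m := by ring
      apply hcm
      refine ⟨p + 1, ?_⟩
      have : (j + 1) * (p + 1) = (p + 1) * (j + 1) := mul_comm _ _
      simp only [Nat.succ_eq_add_one] at h1
      omega
    have h1 := Nat.mul_le_mul_right β hmk
    have h3 : (m - k) * β + k * β = m * β := by
      rw [← add_mul]; congr 1; omega
    have h4 : (j + 2) * m ≤ m * β := by
      rw [mul_comm]; exact Nat.mul_le_mul_left _ (by omega)
    have : (j + 2) * m = (j + 1) * m + m := by ring
    omega

lemma mul_sub_div_of_mod_ne_zero {m k b : ℕ} (hk : 0 < k) (hbm : b < m) (h : k * b % m ≠ 0) :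
    k * (m - b) / m = k - 1 - k * b / m := by
  have hm : 0 < m := by omega
  have h3 := Nat.mod_lt (k * b) hm
  have h4 := Nat.div_add_mod (k * b) m
  have h5 : k * (m - b) + k * b = m * k := by
    rw [← mul_add, Nat.sub_add_cancel hbm.le, mul_comm]
  have hQ : k * b / m + 1 ≤ k := by
    rw [Nat.succ_le_iff, Nat.div_lt_iff_lt_mul hm]
    exact Nat.mul_lt_mul_of_pos_left hbm hk
  obtain ⟨e, he⟩ := Nat.exists_eq_add_of_le hQ
  generalize k * b / m = Q at *
  subst he
  have : m * (Q + 1 + e) = m * Q + m + m * e := by ring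
  have : Q + 1 + e - 1 - Q = e := by omega
  rw [this]
  apply Nat.div_eq_of_lt_le
  · rw [mul_comm]; omega
  · have : (e + 1) * m = m * e + m := by ring
    omega

lemma floor_triple_sorted {m b c d : ℕ} (hcb : c ≤ b) (hdc : d ≤ c) (hd : 0 < d) (hbm : b < m)
    (hsum : b + c + d = m + 1) (hb : Nat.Coprime b m) (hc : Nat.Coprime c m)
    (hfl : ∀ k, 1 ≤ k → k < m → k * b / m + k * c / m + k * d / m + 1 = k) : d = 1 := by
  by_contra hne
  have hm : 0 < m := by omega
  have h2b : m < 2 * b := by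
    by_contra! h
    rcases h.lt_or_eq with h | h
    · have := hfl 2 (by omega) (by omega)
      rw [Nat.div_eq_of_lt h, Nat.div_eq_of_lt (a := 2 * c) (by omega),
        Nat.div_eq_of_lt (a := 2 * d) (by omega)] at this
      omega
    · have : b ∣ m := ⟨2, by omega⟩
      have := Nat.Coprime.eq_one_of_dvd hb this
      omega
  refine floor_split_false (m := m) (β := m - b) (c := c) (d := d) (by omega) (by omega) hdc
    (by omega) ?_ ?_
  · intro h
    have := Nat.Coprime.eq_one_of_dvd hc h
    omega
  · intro k hk hkm
    have h1 := hfl k hk hkm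
    have h2 : k * b % m ≠ 0 := by
      intro h
      have := (hb.symm.dvd_of_dvd_mul_right (Nat.dvd_of_mod_eq_zero h))
      have := Nat.le_of_dvd hk this
      omega
    rw [mul_sub_div_of_mod_ne_zero hk hbm h2]
    generalize k * b / m = x at *
    generalize k * c / m = y at *
    generalize k * d / m = z at *
    omega

/-- An arithmetic form of White's theorem on empty lattice tetrahedra. -/
lemma floor_triple {m b c d : ℕ} (hb0 : 0 < b) (hc0 : 0 < c) (hd0 : 0 < d)
    (hbm : b < m) (hcm : c < m) (hdm : d < m)
    (hsum : b + c + d = m + 1)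
    (hb : Nat.Coprime b m) (hc : Nat.Coprime c m) (hd : Nat.Coprime d m)
    (hfl : ∀ k, 1 ≤ k → k < m → k * b / m + k * c / m + k * d / m + 1 = k) :
    b = 1 ∨ c = 1 ∨ d = 1 := by
  rcases le_total b c with h1 | h1 <;> rcases le_total c d with h2 | h2 <;>
    rcases le_total b d with h3 | h3
  · exact .inl (floor_triple_sorted h2 h1 hb0 hdm (by omega) hd hc
      fun k h h' => by have := hfl k h h'; omega)
  · exact .inl (floor_triple_sorted h2 h1 hb0 hdm (by omega) hd hc
      fun k h h' => by have := hfl k h h'; omega)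
  · exact .inl (floor_triple_sorted h2 h3 hb0 hcm (by omega) hc hd
      fun k h h' => by have := hfl k h h'; omega)
  · exact .inr (.inr (floor_triple_sorted h1 h3 hd0 hcm (by omega) hc hb
      fun k h h' => by have := hfl k h h'; omega))
  · exact .inr (.inl (floor_triple_sorted h3 h1 hc0 hdm (by omega) hd hb
      fun k h h' => by have := hfl k h h'; omega))
  · exact .inr (.inl (floor_triple_sorted h3 h2 hc0 hbm (by omega) hb hd
      fun k h h' => by have := hfl k h h'; omega))
  · exact .inr (.inr (floor_triple_sorted h1 h2 hd0 hbm (by omega) hb hc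
      fun k h h' => by have := hfl k h h'; omega))
  · exact .inr (.inr (floor_triple_sorted h1 h2 hd0 hbm (by omega) hb hc
      fun k h h' => by have := hfl k h h'; omega))

lemma mod_nsmul_of_nsmul_eq_zero {H : Type*} [AddCommGroup H] {m : ℕ} {r : H} (hr : m • r = 0)
    (a : ℕ) : (a % m) • r = a • r := by
  conv_rhs => rw [← Nat.mod_add_div a m, add_nsmul, mul_nsmul, hr, smul_zero, add_zero]

lemma coprime_of_forall_not_dvd {m A : ℕ} (hm : 0 < m)
    (h : ∀ k, 0 < k → k < m → ¬ m ∣ k * A) : Nat.Coprime A m := by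
  by_contra hne
  have hg : 0 < Nat.gcd A m := Nat.gcd_pos_of_pos_right _ hm
  have hg1 : 1 < Nat.gcd A m := by
    have : Nat.gcd A m ≠ 1 := hne
    omega
  obtain ⟨a, ha⟩ := Nat.gcd_dvd_left A m
  obtain ⟨b, hb⟩ := Nat.gcd_dvd_right A m
  generalize Nat.gcd A m = g at *
  refine h b ?_ ?_ ⟨a, ?_⟩
  · rw [Nat.pos_iff_ne_zero]
    rintro rfl
    omega
  · have : 0 < b := by
      rw [Nat.pos_iff_ne_zero]
      rintro rfl
      omega
    nlinarith
  · rw [ha, hb]; ring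

lemma pair_independent {H : Type*} [AddCommGroup H] {m : ℕ} (hmH : ∀ t : H, m • t = 0) {s t : H}
    (hns : ∀ a b : ℕ, a < m → b < m → a • s + b • t = 0 → a + b ≤ m → a = 0 ∧ b = 0)
    {a b : ℕ} (ha : a < m) (hb : b < m) (h : a • s + b • t = 0) : a = 0 ∧ b = 0 := by
  by_cases hab : a + b ≤ m
  · exact hns a b ha hb h hab
  · have h2 : (m - a) • s + (m - b) • t = 0 := by
      have : (m - a) • s + (m - b) • t + (a • s + b • t) = 0 := by
        rw [add_add_add_comm, ← add_nsmul, ← add_nsmul, Nat.sub_add_cancel ha.le,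
          Nat.sub_add_cancel hb.le, hmH, hmH, add_zero]
      rwa [h, add_zero] at this
    have := hns (m - a) (m - b) (by omega) (by omega) h2 (by omega)
    omega

lemma exists_combination {H : Type*} [AddCommGroup H] {m : ℕ} (hm : 0 < m)
    (hmH : ∀ t : H, m • t = 0) (hcard : Nat.card H = m * m) {s t : H}
    (hns : ∀ a b : ℕ, a < m → b < m → a • s + b • t = 0 → a + b ≤ m → a = 0 ∧ b = 0)
    (g : H) : ∃ a b : ℕ, a < m ∧ b < m ∧ a • s + b • t = g := by
  have : Finite H := Nat.finite_of_card_ne_zero (by rw [hcard]; positivity)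
  let f : Fin m × Fin m → H := fun p => (p.1 : ℕ) • s + (p.2 : ℕ) • t
  have key : ∀ a b a' b' : ℕ, a < m → b < m → a' < m → b' < m →
      a • s + b • t = a' • s + b' • t → a ≤ a' → a = a' ∧ b = b' := by
    intro a b a' b' ha hb ha' hb' h haa
    rcases le_total b b' with hbb | hbb
    · have := pair_independent hmH hns (a := a' - a) (b := b' - b) (by omega) (by omega) (by
        have e1 : a' • s = (a' - a) • s + a • s := by rw [← add_nsmul, Nat.sub_add_cancel haa]
        have e2 : b' • t = (b' - b) • t + b • t := by rw [← add_nsmul, Nat.sub_add_cancel hbb]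
        rw [e1, e2, add_add_add_comm] at h
        simpa using h)
      omega
    · rcases hbb.eq_or_lt with hbb | hbb
      · subst hbb
        have := pair_independent hmH hns (a := a' - a) (b := 0) (by omega) (by omega) (by
          have e1 : a' • s = (a' - a) • s + a • s := by rw [← add_nsmul, Nat.sub_add_cancel haa]
          rw [e1] at h
          simpa using h)
        omega
      have := pair_independent hmH hns (a := a' - a) (b := m - (b - b')) (by omega) (by omega) (by
        have e1 : a' • s = (a' - a) • s + a • s := by rw [← add_nsmul, Nat.sub_add_cancel haa]
        have e2 : b • t = (b - b') • t + b' • t := by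
          rw [← add_nsmul, Nat.sub_add_cancel hbb.le]
        have e3 : (m - (b - b')) • t + (b - b') • t = 0 := by
          rw [← add_nsmul, Nat.sub_add_cancel (by omega), hmH]
        rw [e1, e2, ← add_assoc, add_right_cancel_iff, add_comm, add_right_cancel_iff] at h
        rw [← h, add_comm, e3])
      omega
  have hinj : Function.Injective f := by
    rintro ⟨a, b⟩ ⟨a', b'⟩ h
    simp only [f] at h
    rcases le_total (a : ℕ) a' with haa | haa
    · have := key _ _ _ _ a.2 b.2 a'.2 b'.2 h haa
      simp [Fin.ext_iff, this]
    · have := key _ _ _ _ a'.2 b'.2 a.2 b.2 h.symm haa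
      simp [Fin.ext_iff, this]
  have hbij := (Nat.bijective_iff_injective_and_card f).2 ⟨hinj, by simp [hcard]⟩
  obtain ⟨⟨a, b⟩, hab⟩ := hbij.2 g
  exact ⟨a, b, a.2, b.2, hab⟩

lemma exists_labelling {H : Type*} [AddCommGroup H] {m : ℕ} (hm : 2 ≤ m)
    (hmH : ∀ t : H, m • t = 0) (hcard : Nat.card H = m * m) {r s t : H}
    (hns : ∀ a b c : ℕ, a < m → b < m → c < m → a • r + b • s + c • t = 0 → a + b + c ≤ m →
      a = 0 ∧ b = 0 ∧ c = 0) :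
    ∃ (u v w : H) (x : ℕ), ({r, s, t} : Multiset H) = {u, v, w} ∧ 0 < x ∧ x < m ∧
      Nat.Coprime x m ∧ w + x • u = v := by
  have hrs : ∀ a b : ℕ, a < m → b < m → a • r + b • s = 0 → a + b ≤ m → a = 0 ∧ b = 0 := by
    intro a b ha hb h hab
    have := hns a b 0 ha hb (by omega) (by simpa using h) (by omega)
    tauto
  have hrt : ∀ a b : ℕ, a < m → b < m → a • r + b • t = 0 → a + b ≤ m → a = 0 ∧ b = 0 := by
    intro a b ha hb h hab
    have := hns a 0 b ha (by omega) hb (by simpa using h) (by omega)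
    tauto
  have hst : ∀ a b : ℕ, a < m → b < m → a • s + b • t = 0 → a + b ≤ m → a = 0 ∧ b = 0 := by
    intro a b ha hb h hab
    have := hns 0 a b (by omega) ha hb (by simpa using h) (by omega)
    tauto
  obtain ⟨A, B, hA, hB, hAB⟩ := exists_combination (by omega) hmH hcard hrs (-t)
  have hrel : A • r + B • s + t = 0 := by rw [hAB]; simp
  have hmod : ∀ k, (k * A % m) • r + (k * B % m) • s + k • t = 0 := by
    intro k
    rw [mod_nsmul_of_nsmul_eq_zero (hmH r), mod_nsmul_of_nsmul_eq_zero (hmH s), mul_comm k A,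
      mul_comm k B, mul_nsmul, mul_nsmul, ← nsmul_add, ← nsmul_add, hrel, smul_zero]
  have hkA : ∀ k, 0 < k → k < m → ¬ m ∣ k * A := by
    intro k hk hkm hd
    have := hmod k
    rw [Nat.mod_eq_zero_of_dvd hd, zero_smul, zero_add] at this
    have := pair_independent hmH hst (Nat.mod_lt _ (by omega)) hkm this
    omega
  have hkB : ∀ k, 0 < k → k < m → ¬ m ∣ k * B := by
    intro k hk hkm hd
    have := hmod k
    rw [Nat.mod_eq_zero_of_dvd hd, zero_smul, add_zero] at this
    have := pair_independent hmH hrt (Nat.mod_lt _ (by omega)) hkm this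
    omega
  have hcA := coprime_of_forall_not_dvd (by omega) hkA
  have hcB := coprime_of_forall_not_dvd (by omega) hkB
  have hA0 : 0 < A := by
    rw [Nat.pos_iff_ne_zero]; rintro rfl
    exact hkA 1 (by omega) (by omega) (by simp)
  have hB0 : 0 < B := by
    rw [Nat.pos_iff_ne_zero]; rintro rfl
    exact hkB 1 (by omega) (by omega) (by simp)
  have hbound : ∀ k, 0 < k → k < m →
      m < k * A % m + k * B % m + k ∧ k * A % m + k * B % m + k < 2 * m := by
    intro k hk hkm
    have h1 := Nat.mod_lt (k * A) (show m > 0 by omega)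
    have h2 := Nat.mod_lt (k * B) (show m > 0 by omega)
    have h3 : k * A % m ≠ 0 := fun h => hkA k hk hkm (Nat.dvd_of_mod_eq_zero h)
    have h4 : k * B % m ≠ 0 := fun h => hkB k hk hkm (Nat.dvd_of_mod_eq_zero h)
    have h0 := hmod k
    generalize k * A % m = α at *
    generalize k * B % m = β at *
    constructor
    · by_contra! h
      have := hns α β k h1 h2 hkm h0 h
      omega
    · by_contra! h
      have e : (m - α) • r + (m - β) • s + (m - k) • t = 0 := by
        have : (m - α) • r + (m - β) • s + (m - k) • t + (α • r + β • s + k • t) = 0 := by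
          rw [add_add_add_comm, add_add_add_comm ((m - α) • r), ← add_nsmul, ← add_nsmul,
            ← add_nsmul,
            Nat.sub_add_cancel h1.le, Nat.sub_add_cancel h2.le, Nat.sub_add_cancel hkm.le]
          simp [hmH]
        rwa [h0, add_zero] at this
      have := hns _ _ _ (by omega) (by omega) (by omega) e (by omega)
      omega
  have hD := hbound 1 (by omega) (by omega)
  rw [one_mul, one_mul, Nat.mod_eq_of_lt hA, Nat.mod_eq_of_lt hB] at hD
  obtain ⟨D, hDdef⟩ := Nat.exists_eq_add_of_lt hD.1
  have hkD : ∀ k, 0 < k → k < m → ¬ m ∣ k * (D + 1) ∧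
      k * (m - A) / m + k * (m - B) / m + k * (D + 1) / m + 1 = k := by
    intro k hk hkm
    have h1 := Nat.mod_lt (k * A) (show m > 0 by omega)
    have h2 := Nat.mod_lt (k * B) (show m > 0 by omega)
    have h3 : k * A % m ≠ 0 := fun h => hkA k hk hkm (Nat.dvd_of_mod_eq_zero h)
    have h4 : k * B % m ≠ 0 := fun h => hkB k hk hkm (Nat.dvd_of_mod_eq_zero h)
    obtain ⟨b1, b2⟩ := hbound k hk hkm
    have d1 := Nat.div_add_mod (k * A) m
    have d2 := Nat.div_add_mod (k * B) m
    have d3 : k * A / m < k := by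
      rw [Nat.div_lt_iff_lt_mul (by omega)]; exact Nat.mul_lt_mul_of_pos_left hA hk
    have d4 : k * B / m < k := by
      rw [Nat.div_lt_iff_lt_mul (by omega)]; exact Nat.mul_lt_mul_of_pos_left hB hk
    rw [mul_sub_div_of_mod_ne_zero hk hA h3, mul_sub_div_of_mod_ne_zero hk hB h4]
    generalize k * A % m = α at *
    generalize k * B % m = β at *
    generalize k * A / m = a at *
    generalize k * B / m = b at *
    have e : k * (D + 1) + k * m = m * (a + b) + (α + β + k) := by
      have : A + B + 1 = D + 1 + m := by omega
      calc k * (D + 1) + k * m = k * (D + 1 + m) := by ring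
        _ = k * A + k * B + k := by rw [← this]; ring
        _ = _ := by rw [← d1, ← d2]; ring
    have d5 : k ≤ a + b + 1 := by
      by_contra! h
      have : (a + b + 2) * m ≤ k * m := Nat.mul_le_mul_right _ h
      have : (a + b + 2) * m = m * (a + b) + 2 * m := by ring
      omega
    obtain ⟨f, hf⟩ := Nat.exists_eq_add_of_le d5
    have e' : k * (D + 1) + m = m * f + (α + β + k) := by
      have : m * (a + b) + m = m * k + m * f := by rw [← mul_add, ← hf]; ring
      have : k * m = m * k := mul_comm _ _
      omega
    have f3 : k * (D + 1) / m = f := by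
      apply Nat.div_eq_of_lt_le
      · rw [mul_comm f m]; omega
      · have : (f + 1) * m = m * f + m := by ring
        omega
    refine ⟨?_, by omega⟩
    intro hdvd
    have := Nat.div_mul_cancel hdvd
    rw [f3, mul_comm f m] at this
    omega
  have hcD := coprime_of_forall_not_dvd (by omega) (fun k h h' => (hkD k h h').1)
  rcases floor_triple (m := m) (b := m - A) (c := m - B) (d := D + 1) (by omega) (by omega)
    (by omega) (by omega) (by omega) (by omega) (by omega)
    ((Nat.coprime_self_sub_left hA.le).2 hcA.symm.symm)
    ((Nat.coprime_self_sub_left hB.le).2 hcB.symm.symm) hcD (fun k h h' => (hkD k h h').2)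
    with h | h | h
  · refine ⟨s, r, t, B, ?_, hB0, hB, hcB, ?_⟩
    · exact Multiset.cons_swap _ _ _
    · have e : A + 1 = m := by omega
      have := hmH r
      rw [← e, add_nsmul, one_nsmul] at this
      have h2 : A • r = - r := by rwa [add_eq_zero_iff_eq_neg] at this
      rw [h2, add_assoc, neg_add_eq_zero] at hrel
      rw [hrel, add_comm]
  · refine ⟨r, s, t, A, rfl, hA0, hA, hcA, ?_⟩
    have e : B + 1 = m := by omega
    have := hmH s
    rw [← e, add_nsmul, one_nsmul] at this
    have h2 : B • s = - s := by rwa [add_eq_zero_iff_eq_neg] at this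
    rw [h2, add_right_comm, ← sub_eq_add_neg, sub_eq_zero] at hrel
    rw [← hrel, add_comm]
  · obtain ⟨y, hym, hy⟩ := Nat.exists_mul_mod_eq_one_of_coprime hcA (by omega)
    refine ⟨t, s, r, y, ?_, ?_, hym, ?_, ?_⟩
    · have : ({r, s, t} : Multiset H) = {s, t, r} := by
        simp only [Multiset.insert_eq_cons, ← Multiset.singleton_add]
        abel
      rw [this]
      simp only [Multiset.insert_eq_cons, ← Multiset.singleton_add]
      abel
    · rw [Nat.pos_iff_ne_zero]; rintro rfl; simp at hy
    · refine Nat.coprime_of_mul_modEq_one A ?_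
      rw [Nat.ModEq, mul_comm, hy, Nat.mod_eq_of_lt (by omega)]
    · have e : A + B = m := by omega
      have h1 := hmH s
      rw [← e, add_nsmul] at h1
      have h2 : B • s = - (A • s) := by rwa [add_comm, add_eq_zero_iff_eq_neg] at h1
      have h3 : y • (A • r + B • s + t) = 0 := by rw [hrel, smul_zero]
      rw [h2, nsmul_add, nsmul_add, smul_neg, ← mul_nsmul, ← mul_nsmul,
        ← mod_nsmul_of_nsmul_eq_zero (hmH r) (A * y),
        ← mod_nsmul_of_nsmul_eq_zero (hmH s) (A * y), hy, one_nsmul, one_nsmul] at h3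
      rw [← sub_eq_zero, ← h3]
      abel

lemma Multiset.exists_le_map_eq {α β : Type*} {f : α → β} {X : Multiset α} {U : Multiset β}
    (h : U ≤ X.map f) : ∃ Y ≤ X, Y.map f = U := by
  have : U ∈ Multiset.powersetCard U.card (X.map f) := Multiset.mem_powersetCard.2 ⟨h, rfl⟩
  rw [Multiset.powersetCard_map, Multiset.mem_map] at this
  obtain ⟨Y, hY, rfl⟩ := this
  exact ⟨Y, (Multiset.mem_powersetCard.1 hY).1, rfl⟩

lemma Multiset.exists_le_card_eq_of_le {α : Type*} {X : Multiset α} {k : ℕ} (h : k ≤ X.card) :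
    ∃ Y ≤ X, Y.card = k := by
  have : 0 < (Multiset.powersetCard k X).card := by
    rw [Multiset.card_powersetCard]; exact Nat.choose_pos h
  obtain ⟨Y, hY⟩ := Multiset.card_pos_iff_exists_mem.1 this
  exact ⟨Y, Multiset.mem_powersetCard.1 hY⟩

lemma Multiset.sum_mono_of_le {α : Type*} {B' B : Multiset (Multiset α)} (h : B' ≤ B) :
    B'.sum ≤ B.sum := by
  obtain ⟨C, rfl⟩ := Multiset.le_iff_exists_add.1 h
  simp

/-- The number of subsequence sums of a zero-sum free sequence exceeds its length. -/
lemma card_subsequence_sums {G : Type*} [AddCommGroup G] [DecidableEq G] (M : Multiset G)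
    (hz : ∀ U ≤ M, U ≠ 0 → U.sum ≠ 0) :
    M.card + 1 ≤ (M.powerset.map Multiset.sum).toFinset.card := by
  induction M using Multiset.induction_on with
  | empty => simp
  | cons a M ih =>
    have ih := ih fun U hU => hz U (hU.trans (Multiset.le_cons_self _ _))
    rw [Multiset.card_cons]
    refine Nat.lt_of_le_of_lt ih (Finset.card_lt_card ?_)
    have hmem : ∀ (N : Multiset G) (g : G),
        g ∈ (N.powerset.map Multiset.sum).toFinset ↔ ∃ U ≤ N, U.sum = g := by
      intro N g
      simp
    rw [Finset.ssubset_iff_subset_ne]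
    refine ⟨?_, fun heq => ?_⟩
    · intro g hg
      rw [hmem] at hg ⊢
      obtain ⟨U, hU, h⟩ := hg
      exact ⟨U, hU.trans (Multiset.le_cons_self _ _), h⟩
    · have himg : ((M.powerset.map Multiset.sum).toFinset.image (a + ·)) =
          (M.powerset.map Multiset.sum).toFinset := by
        apply Finset.eq_of_subset_of_card_le
        · intro g hg
          rw [Finset.mem_image] at hg
          obtain ⟨y, hy, rfl⟩ := hg
          rw [heq, hmem]
          rw [hmem] at hy
          obtain ⟨U, hU, rfl⟩ := hy
          exact ⟨a ::ₘ U, Multiset.cons_le_cons _ hU, by simp⟩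
        · rw [Finset.card_image_of_injective _ (add_right_injective a)]
      have h0 : (0 : G) ∈ (M.powerset.map Multiset.sum).toFinset := by
        rw [hmem]; exact ⟨0, Multiset.zero_le _, rfl⟩
      rw [← himg, Finset.mem_image] at h0
      obtain ⟨y, hy, hay⟩ := h0
      rw [hmem] at hy
      obtain ⟨U, hU, rfl⟩ := hy
      exact hz (a ::ₘ U) (Multiset.cons_le_cons _ hU) (Multiset.cons_ne_zero) (by simpa using hay)

lemma card_lt_of_zero_sum_free {G : Type*} [AddCommGroup G] {K : AddSubgroup G}
    {n : ℕ} (hn : 0 < n) (hK : Nat.card K = n) {M : Multiset G} (hM : ∀ g ∈ M, g ∈ K)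
    (hz : ∀ U ≤ M, U ≠ 0 → U.sum ≠ 0) : M.card < n := by
  classical
  have hfin : Finite K := Nat.finite_of_card_ne_zero (by omega)
  have hfinset : (K : Set G).Finite := hfin
  refine lt_of_lt_of_le (card_subsequence_sums M hz) ?_
  have : hfinset.toFinset.card = n := by
    rw [← hK]; exact (Nat.card_eq_card_finite_toFinset hfinset).symm
  rw [← this]
  apply Finset.card_le_card
  intro g hg
  simp only [Multiset.mem_toFinset, Multiset.mem_map, Multiset.mem_powerset] at hg
  obtain ⟨U, hU, rfl⟩ := hg
  simp only [Set.Finite.mem_toFinset, SetLike.mem_coe]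
  exact K.multiset_sum_mem _ fun g hg => hM g (Multiset.mem_of_le hU hg)

lemma eq_of_zero_sum_free {G : Type*} [AddCommGroup G] {K : AddSubgroup G}
    {n : ℕ} (hn : 0 < n) (hK : Nat.card K = n) {M : Multiset G} (hM : ∀ g ∈ M, g ∈ K)
    (hz : ∀ U ≤ M, U ≠ 0 → U.sum ≠ 0) (hcard : n ≤ M.card + 2) {x y : G} (hx : x ∈ K)
    (hy : y ∈ K) (hxM : ∀ U ≤ M, U.sum + x ≠ 0) (hyM : ∀ U ≤ M, U.sum + y ≠ 0) : x = y := by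
  classical
  have hfin : Finite K := Nat.finite_of_card_ne_zero (by omega)
  have hfinset : (K : Set G).Finite := hfin
  have hKc : hfinset.toFinset.card = n := by
    rw [← hK]; exact (Nat.card_eq_card_finite_toFinset hfinset).symm
  have h1 := card_subsequence_sums M hz
  have hnot : ∀ z : G, (∀ U ≤ M, U.sum + z ≠ 0) →
      -z ∉ (M.powerset.map Multiset.sum).toFinset := by
    intro z hz h
    simp only [Multiset.mem_toFinset, Multiset.mem_map, Multiset.mem_powerset] at h
    obtain ⟨U, hU, h⟩ := h
    exact hz U hU (by rw [h]; simp)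
  have heq : insert (-x) (M.powerset.map Multiset.sum).toFinset = hfinset.toFinset := by
    apply Finset.eq_of_subset_of_card_le
    · intro g hg
      rw [Finset.mem_insert] at hg
      simp only [Multiset.mem_toFinset, Multiset.mem_map, Multiset.mem_powerset] at hg
      simp only [Set.Finite.mem_toFinset, SetLike.mem_coe]
      rcases hg with rfl | ⟨U, hU, rfl⟩
      · exact K.neg_mem hx
      · exact K.multiset_sum_mem _ fun g hg => hM g (Multiset.mem_of_le hU hg)
    · rw [Finset.card_insert_of_notMem (hnot x hxM), hKc]
      omega
  have : -y ∈ hfinset.toFinset := by simpa using hy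
  rw [← heq, Finset.mem_insert] at this
  rcases this with h | h
  · simpa using h.symm
  · exact absurd h (hnot y hyM)

/-- A nonempty sequence of length at most `m` whose image under `π` has sum zero. -/
structure IsBlock {G H : Type*} [AddCommGroup G] [AddCommGroup H] (π : G →+ H) (m : ℕ)
    (X : Multiset G) : Prop where
  ne_zero : X ≠ 0
  card_le : X.card ≤ m
  map_sum : π X.sum = 0

section Blocks

variable {G H : Type*} [AddCommGroup G] [AddCommGroup H] {π : G →+ H} {m n : ℕ} {S : Multiset G}

lemma card_sum_le_of_blocks {B : Multiset (Multiset G)} (hB : ∀ X ∈ B, IsBlock π m X) :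
    B.sum.card ≤ m * B.card := by
  induction B using Multiset.induction_on with
  | empty => simp
  | cons X B ih =>
    have h1 := (hB X (Multiset.mem_cons_self _ _)).card_le
    have h2 := ih fun Y hY => hB Y (Multiset.mem_cons_of_mem hY)
    simp only [Multiset.sum_cons, Multiset.card_add, Multiset.card_cons, mul_add]
    omega

lemma sum_ne_zero_of_blocks {B : Multiset (Multiset G)} (hB : ∀ X ∈ B, IsBlock π m X)
    (h0 : B ≠ 0) : B.sum ≠ 0 := by
  obtain ⟨X, hX⟩ := Multiset.exists_mem_of_ne_zero h0
  obtain ⟨B', rfl⟩ := Multiset.exists_cons_of_mem hX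
  have := (hB X hX).ne_zero
  intro h
  rw [Multiset.sum_cons, add_eq_zero] at h
  exact this h.1

lemma sum_map_sum (B : Multiset (Multiset G)) : (B.map Multiset.sum).sum = B.sum.sum := by
  induction B using Multiset.induction_on with
  | empty => simp
  | cons X B ih => simp [ih]

lemma blocks_zero_sum_free (hS : ∀ Q ≤ S, Q ≠ 0 → Q.card ≤ m * n → Q.sum ≠ 0)
    {B : Multiset (Multiset G)} (hB : ∀ X ∈ B, IsBlock π m X) (hBS : B.sum ≤ S)
    (hBn : B.card ≤ n) : ∀ U ≤ B.map Multiset.sum, U ≠ 0 → U.sum ≠ 0 := by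
  intro U hU hU0
  obtain ⟨C, hC, rfl⟩ := Multiset.exists_le_map_eq hU
  have hCB : ∀ X ∈ C, IsBlock π m X := fun X hX => hB X (Multiset.mem_of_le hC hX)
  have hC0 : C ≠ 0 := by rintro rfl; exact hU0 rfl
  rw [sum_map_sum]
  refine hS _ ((Multiset.sum_mono_of_le hC).trans hBS) (sum_ne_zero_of_blocks hCB hC0) ?_
  exact (card_sum_le_of_blocks hCB).trans
    (Nat.mul_le_mul_left _ ((Multiset.card_le_card hC).trans hBn))

lemma blocks_mem_ker {B : Multiset (Multiset G)} (hB : ∀ X ∈ B, IsBlock π m X) :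
    ∀ g ∈ B.map Multiset.sum, g ∈ π.ker := by
  intro g hg
  rw [Multiset.mem_map] at hg
  obtain ⟨X, hX, rfl⟩ := hg
  exact (hB X hX).map_sum

lemma card_blocks_lt (hn : 0 < n) (hK : Nat.card π.ker = n)
    (hS : ∀ Q ≤ S, Q ≠ 0 → Q.card ≤ m * n → Q.sum ≠ 0)
    {B : Multiset (Multiset G)} (hB : ∀ X ∈ B, IsBlock π m X) (hBS : B.sum ≤ S) :
    B.card < n := by
  by_contra! h
  obtain ⟨C, hC, hCn⟩ := Multiset.exists_le_card_eq_of_le h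
  have hCB : ∀ X ∈ C, IsBlock π m X := fun X hX => hB X (Multiset.mem_of_le hC hX)
  have := card_lt_of_zero_sum_free hn hK (blocks_mem_ker hCB)
    (blocks_zero_sum_free hS hCB ((Multiset.sum_mono_of_le hC).trans hBS) hCn.le)
  rw [Multiset.card_map] at this
  omega

lemma sum_eq_sum_of_blocks (hn : 0 < n) (hK : Nat.card π.ker = n)
    (hS : ∀ Q ≤ S, Q ≠ 0 → Q.card ≤ m * n → Q.sum ≠ 0)
    {B : Multiset (Multiset G)} (hB : ∀ X ∈ B, IsBlock π m X) {V W W' : Multiset G}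
    (hBS : V + B.sum ≤ S) (hBn : n ≤ B.card + 2) (hW : W ≤ V) (hW' : W' ≤ V) (hW0 : W ≠ 0)
    (hW'0 : W' ≠ 0) (hWc : W.card ≤ 2 * m) (hW'c : W'.card ≤ 2 * m) (hWπ : π W.sum = 0)
    (hW'π : π W'.sum = 0) : W.sum = W'.sum := by
  rcases Nat.lt_or_ge n 2 with hn2 | hn2
  · have h1 : n = 1 := by omega
    subst h1
    have hsub : Subsingleton π.ker := (Nat.card_eq_one_iff_unique.1 hK).1
    have := hsub.elim ⟨W.sum, hWπ⟩ ⟨W'.sum, hW'π⟩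
    exact congrArg Subtype.val this
  obtain ⟨C, hC, hCn⟩ := Multiset.exists_le_card_eq_of_le (show n - 2 ≤ B.card by omega)
  have hCB : ∀ X ∈ C, IsBlock π m X := fun X hX => hB X (Multiset.mem_of_le hC hX)
  have hCS : V + C.sum ≤ S :=
    (add_le_add_right (Multiset.sum_mono_of_le hC) _).trans hBS
  have key : ∀ W ≤ V, W ≠ 0 → W.card ≤ 2 * m → ∀ U ≤ C.map Multiset.sum, U.sum + W.sum ≠ 0 := by
    intro W hW hW0 hWc U hU
    obtain ⟨D, hD, rfl⟩ := Multiset.exists_le_map_eq hU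
    rw [sum_map_sum, ← Multiset.sum_add]
    refine hS _ ?_ ?_ ?_
    · rw [add_comm]
      exact (add_le_add hW (Multiset.sum_mono_of_le hD)).trans hCS
    · intro h
      exact hW0 (add_eq_zero.1 h).2
    · have h1 := card_sum_le_of_blocks (fun X hX => hCB X (Multiset.mem_of_le hD hX))
      have h2 := Nat.mul_le_mul_left m (Multiset.card_le_card hD)
      have h3 : m * n = m * (n - 2) + 2 * m := by
        rw [mul_comm 2 m, ← mul_add, Nat.sub_add_cancel hn2]
      rw [Multiset.card_add, h3]
      rw [hCn] at h2
      omega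
  exact eq_of_zero_sum_free hn hK (blocks_mem_ker hCB)
    (blocks_zero_sum_free hS hCB ((Multiset.le_add_left _ _).trans hCS) (by omega))
    (by rw [Multiset.card_map]; omega) hWπ hW'π (key W hW hW0 hWc) (key W' hW' hW'0 hW'c)

lemma exists_blocks_of_short [DecidableEq G]
    (hη : ∀ P : Multiset H, 3 * m - 2 ≤ P.card → ∃ U ≤ P, U ≠ 0 ∧ U.sum = 0 ∧ U.card ≤ m)
    (k : ℕ) (P : Multiset G) (hP : k * m + (2 * m - 2) ≤ P.card) :
    ∃ B : Multiset (Multiset G), B.card = k ∧ (∀ X ∈ B, IsBlock π m X) ∧ B.sum ≤ P := by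
  induction k generalizing P with
  | zero => exact ⟨0, by simp⟩
  | succ k ih =>
    obtain ⟨U, hU, hU0, hUs, hUc⟩ := hη (P.map π) (by
      rw [Multiset.card_map]
      have : (k + 1) * m = k * m + m := by ring
      omega)
    obtain ⟨X, hX, rfl⟩ := Multiset.exists_le_map_eq hU
    rw [Multiset.card_map] at hUc
    have hblock : IsBlock π m X :=
      ⟨by rintro rfl; exact hU0 rfl, hUc, by rw [map_multiset_sum, hUs]⟩
    obtain ⟨B, hB1, hB2, hB3⟩ := ih (P - X) (by
      rw [Multiset.card_sub hX]
      have : (k + 1) * m = k * m + m := by ring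
      omega)
    refine ⟨X ::ₘ B, by simp [hB1], ?_, ?_⟩
    · intro Y hY
      rcases Multiset.mem_cons.1 hY with rfl | hY
      · exact hblock
      · exact hB2 Y hY
    · rw [Multiset.sum_cons]
      calc X + B.sum ≤ X + (P - X) := add_le_add_right hB3 _
        _ = P := add_tsub_cancel_of_le hX

lemma exists_blocks_of_fibre [DecidableEq G] (hm : 0 < m) {t : H} (ht : m • t = 0)
    (k : ℕ) (P : Multiset G) (hPt : ∀ g ∈ P, π g = t) (hP : k * m ≤ P.card) :
    ∃ B : Multiset (Multiset G), B.card = k ∧ (∀ X ∈ B, IsBlock π m X) ∧ B.sum ≤ P := by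
  induction k generalizing P with
  | zero => exact ⟨0, by simp⟩
  | succ k ih =>
    have e : (k + 1) * m = k * m + m := by ring
    obtain ⟨X, hX, hXc⟩ := Multiset.exists_le_card_eq_of_le (show m ≤ P.card by omega)
    have hblock : IsBlock π m X := by
      refine ⟨by rintro rfl; simp at hXc; omega, hXc.le, ?_⟩
      have : X.map π = Multiset.replicate m t := by
        rw [Multiset.eq_replicate]
        refine ⟨by simp [hXc], fun b hb => ?_⟩
        rw [Multiset.mem_map] at hb
        obtain ⟨g, hg, rfl⟩ := hb
        exact hPt g (Multiset.mem_of_le hX hg)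
      rw [map_multiset_sum, this, Multiset.sum_replicate, ht]
    obtain ⟨B, hB1, hB2, hB3⟩ := ih (P - X)
      (fun g hg => hPt g (Multiset.mem_of_le (Multiset.sub_le_self _ _) hg)) (by
        rw [Multiset.card_sub hX]
        omega)
    refine ⟨X ::ₘ B, by simp [hB1], ?_, ?_⟩
    · intro Y hY
      rcases Multiset.mem_cons.1 hY with rfl | hY
      · exact hblock
      · exact hB2 Y hY
    · rw [Multiset.sum_cons]
      calc X + B.sum ≤ X + (P - X) := add_le_add_right hB3 _
        _ = P := add_tsub_cancel_of_le hX

end Blocks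

lemma exists_short_of_propC {H : Type*} [AddCommGroup H] {m : ℕ} (hm : 2 ≤ m)
    (hmH : ∀ t : H, m • t = 0) (hcard : Nat.card H = m * m)
    (hC : ∀ S : Multiset H, S.card = 3 * m - 3 →
      (¬ ∃ U ≤ S, U ≠ 0 ∧ U.sum = 0 ∧ Multiset.card U ≤ m) →
      ∃ T : Multiset H, T.card = 3 ∧ S = (m - 1) • T)
    (P : Multiset H) (hP : 3 * m - 2 ≤ P.card) :
    ∃ U ≤ P, U ≠ 0 ∧ U.sum = 0 ∧ U.card ≤ m := by
  classical
  obtain ⟨P', hP', hPc⟩ := Multiset.exists_le_card_eq_of_le hP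
  suffices ∃ U ≤ P', U ≠ 0 ∧ U.sum = 0 ∧ U.card ≤ m by
    obtain ⟨U, hU, h⟩ := this
    exact ⟨U, hU.trans hP', h⟩
  clear hP hP' P
  by_contra hno
  rcases hm.eq_or_lt with rfl | hm3
  · have hnd : P'.Nodup := by
      rw [Multiset.nodup_iff_le]
      intro a ha
      exact hno ⟨{a, a}, ha, by simp, by simpa [two_nsmul] using hmH a, by simp⟩
    have h0 : (0 : H) ∉ P' := by
      intro h
      exact hno ⟨{0}, by simpa using h, by simp, by simp, by simp⟩
    have : Finite H := Nat.finite_of_card_ne_zero (by omega)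
    have := Fintype.ofFinite H
    have h1 := Finset.card_le_univ (insert 0 P'.toFinset)
    rw [Finset.card_insert_of_notMem (by simpa using h0), Multiset.toFinset_card_of_nodup hnd,
      ← Nat.card_eq_fintype_card, hcard] at h1
    omega
  · have hdiv : ∀ a ∈ P', ∀ t, (m - 1) ∣ (P'.erase a).count t := by
      intro a ha t
      obtain ⟨T, -, hT⟩ := hC (P'.erase a) (by rw [Multiset.card_erase_of_mem ha, Nat.pred_eq_sub_one]; omega) (by
        rintro ⟨U, hU, h⟩
        exact hno ⟨U, hU.trans (Multiset.erase_le _ _), h⟩)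
      rw [hT, Multiset.count_nsmul]
      exact dvd_mul_right _ _
    have hconst : ∀ a ∈ P', ∀ t ∈ P', a = t := by
      intro a ha t ht
      by_contra hne
      have h1 := hdiv a ha t
      have h2 := hdiv t ht t
      rw [Multiset.count_erase_of_ne (Ne.symm hne)] at h1
      rw [Multiset.count_erase_self] at h2
      have h3 : 0 < P'.count t := Multiset.count_pos.2 ht
      have h4 := Nat.dvd_sub h1 h2
      rw [show P'.count t - (P'.count t - 1) = 1 by omega] at h4
      have := Nat.le_of_dvd one_pos h4
      omega
    obtain ⟨a, ha⟩ := Multiset.card_pos_iff_exists_mem.1 (show 0 < P'.card by omega)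
    have : P' = Multiset.replicate (3 * m - 2) a :=
      Multiset.eq_replicate.2 ⟨hPc, fun b hb => (hconst a ha b hb).symm⟩
    refine hno ⟨Multiset.replicate m a, ?_, ?_, ?_, by simp⟩
    · rw [this, Multiset.replicate_le_replicate]; omega
    · intro h
      have := congrArg Multiset.card h
      simp at this
      omega
    · rw [Multiset.sum_replicate, hmH]

lemma mem_of_exchange {H : Type*} [AddCommGroup H] [DecidableEq H] {m : ℕ} (hm : 2 ≤ m)
    (hmH : ∀ t : H, m • t = 0) {T X : Multiset H} (hTc : T.card = 3) (hXc : X.card = m)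
    (hX0 : X.sum = 0)
    (hη : ∀ P : Multiset H, 3 * m - 2 ≤ P.card → ∃ U ≤ P, U ≠ 0 ∧ U.sum = 0 ∧ U.card ≤ m)
    (hR : ∀ U ≤ (m - 1) • T, U ≠ 0 → U.sum = 0 → m < U.card)
    (hD : ∀ U ≤ X + (m - 1) • T, U ≠ 0 → U.sum = 0 → U.card ≤ m → U.card = m ∧
      ∃ T' : Multiset H, X + (m - 1) • T - U = (m - 1) • T') :
    ∀ g ∈ X, g ∈ T := by
  have hneg : ∀ t g : H, (m - 1) • t + g = 0 → g = t := by
    intro t g h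
    have h2 := hmH t
    rw [← Nat.sub_add_cancel (show 1 ≤ m by omega), add_nsmul, one_nsmul, ← h] at h2
    exact (add_left_cancel h2).symm
  have hdvd : ∀ U ≤ X + (m - 1) • T, U ≠ 0 → U.sum = 0 → U.card ≤ m → ∀ t,
      (m - 1) ∣ X.count t + (m - 1) * T.count t - U.count t := by
    intro U hU h0 hs hc t
    obtain ⟨T', hT'⟩ := (hD U hU h0 hs hc).2
    have := congrArg (Multiset.count t) hT'
    rw [Multiset.count_sub, Multiset.count_add, Multiset.count_nsmul, Multiset.count_nsmul] at this
    exact ⟨_, this⟩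
  intro g hg
  by_contra hgT
  have hgT0 : T.count g = 0 := Multiset.count_eq_zero.2 hgT
  by_cases hXT : ∃ t ∈ X, t ∈ T
  · obtain ⟨t, htX, htT⟩ := hXT
    have htg : t ≠ g := by rintro rfl; exact hgT htT
    have h1 := hdvd (Multiset.replicate m t) (by
        rw [← Multiset.le_count_iff_replicate_le, Multiset.count_add, Multiset.count_nsmul]
        have h1 := Multiset.one_le_count_iff_mem.2 htX
        have h2 := Nat.mul_le_mul_left (m - 1) (Multiset.one_le_count_iff_mem.2 htT)
        omega) (by
        intro h
        have := congrArg Multiset.card h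
        simp at this
        omega) (by rw [Multiset.sum_replicate, hmH]) (by simp) g
    rw [hgT0, Multiset.count_replicate, if_neg htg, mul_zero, add_zero, Nat.sub_zero] at h1
    have h2 := Nat.le_of_dvd (Multiset.count_pos.2 hg) h1
    have hle : t ::ₘ Multiset.replicate (m - 1) g ≤ X := by
      rw [Multiset.cons_le_of_notMem (by
        intro h; exact htg (Multiset.eq_of_mem_replicate h))]
      exact ⟨htX, Multiset.le_count_iff_replicate_le.1 h2⟩
    have heq := Multiset.eq_of_le_of_card_le hle (by simp; omega)
    rw [← heq, Multiset.sum_cons, Multiset.sum_replicate, add_comm] at hX0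
    exact htg (hneg _ _ hX0)
  · push Not at hXT
    obtain ⟨U, hU, hU0, hUs, hUc⟩ := hη (g ::ₘ (m - 1) • T) (by
      rw [Multiset.card_cons, Multiset.card_nsmul, hTc]; omega)
    have hgU : g ∈ U := by
      by_contra h
      have := hR U ((Multiset.le_cons_of_notMem h).1 hU) hU0 hUs
      omega
    obtain ⟨V, rfl⟩ := Multiset.exists_cons_of_mem hgU
    rw [Multiset.cons_le_cons_iff] at hU
    have hUX : g ::ₘ V ≤ X + (m - 1) • T := by
      rw [← Multiset.singleton_add]
      exact add_le_add (by simpa using hg) hU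
    have hcardU := (hD _ hUX hU0 hUs hUc).1
    rw [Multiset.card_cons] at hcardU
    obtain ⟨t, ht⟩ := Multiset.card_pos_iff_exists_mem.1 (show 0 < V.card by omega)
    have htT : t ∈ T := Multiset.mem_of_mem_nsmul (Multiset.mem_of_le hU ht)
    have htg : t ≠ g := by rintro rfl; exact hgT htT
    have h1 := hdvd _ hUX hU0 hUs hUc t
    have hXt : X.count t = 0 := Multiset.count_eq_zero.2 fun h => hXT t h htT
    have hle := Multiset.count_le_of_le t hU
    rw [Multiset.count_nsmul] at hle
    rw [hXt, zero_add, Multiset.count_cons_of_ne htg] at h1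
    have h2 := (Nat.dvd_sub_iff_right hle (dvd_mul_right _ _)).1 h1
    have h3 := Nat.le_of_dvd (Multiset.count_pos.2 ht) h2
    have hV : V = Multiset.replicate (m - 1) t :=
      (Multiset.eq_of_le_of_card_le (Multiset.le_count_iff_replicate_le.1 h3)
        (by simp; omega)).symm
    rw [Multiset.sum_cons, hV, Multiset.sum_replicate, add_comm] at hUs
    exact htg (hneg _ _ hUs).symm

lemma exists_support {G H : Type*} [AddCommGroup G] [AddCommGroup H] {π : G →+ H} {m n : ℕ}
    (hm : 2 ≤ m) (hn : 0 < n) (hmH : ∀ t : H, m • t = 0) (hcard : Nat.card H = m * m)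
    (hK : Nat.card π.ker = n)
    (hC : ∀ S : Multiset H, S.card = 3 * m - 3 →
      (¬ ∃ U ≤ S, U ≠ 0 ∧ U.sum = 0 ∧ Multiset.card U ≤ m) →
      ∃ T : Multiset H, T.card = 3 ∧ S = (m - 1) • T)
    {S : Multiset G} (hSc : S.card = 2 * m + m * n - 3)
    (hS : ∀ Q ≤ S, Q ≠ 0 → Q.card ≤ m * n → Q.sum ≠ 0) :
    ∃ T : Multiset H, T.card = 3 ∧ (∀ g ∈ S, π g ∈ T) ∧
      ∀ U ≤ (m - 1) • T, U ≠ 0 → U.sum = 0 → m < U.card := by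
  classical
  have hη := exists_short_of_propC hm hmH hcard hC
  obtain ⟨N, rfl⟩ : ∃ N, n = N + 1 := ⟨n - 1, by omega⟩
  have hmN : m * (N + 1) = m * N + m := by ring
  have hrem : ∀ B : Multiset (Multiset G), (∀ X ∈ B, IsBlock π m X) → B.card = N → B.sum ≤ S →
      B.sum.card = m * N ∧ ∃ T : Multiset H, T.card = 3 ∧ (S - B.sum).map π = (m - 1) • T ∧
        ∀ U ≤ (m - 1) • T, U ≠ 0 → U.sum = 0 → m < U.card := by
    intro B hB hBN hBS
    have h1 := card_sum_le_of_blocks hB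
    rw [hBN] at h1
    have hno : ¬ ∃ U ≤ (S - B.sum).map π, U ≠ 0 ∧ U.sum = 0 ∧ U.card ≤ m := by
      rintro ⟨U, hU, hU0, hUs, hUc⟩
      obtain ⟨X, hX, rfl⟩ := Multiset.exists_le_map_eq hU
      rw [Multiset.card_map] at hUc
      have hblock : IsBlock π m X :=
        ⟨by rintro rfl; exact hU0 rfl, hUc, by rw [map_multiset_sum, hUs]⟩
      have := card_blocks_lt (B := X ::ₘ B) hn hK hS (by
          intro Y hY
          rcases Multiset.mem_cons.1 hY with rfl | hY
          · exact hblock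
          · exact hB Y hY) (by
          rw [Multiset.sum_cons]
          calc X + B.sum ≤ (S - B.sum) + B.sum := add_le_add_left hX _
            _ = S := tsub_add_cancel_of_le hBS)
      rw [Multiset.card_cons] at this
      omega
    have h2 : ¬ 3 * m - 2 ≤ ((S - B.sum).map π).card := fun h => hno (hη _ h)
    have h3 := Multiset.card_sub hBS
    rw [Multiset.card_map] at h2
    obtain ⟨T, hT3, hT⟩ := hC ((S - B.sum).map π) (by rw [Multiset.card_map]; omega) hno
    refine ⟨by omega, T, hT3, hT, ?_⟩
    intro U hU hU0 hUs
    by_contra! h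
    exact hno ⟨U, hT ▸ hU, hU0, hUs, h⟩
  obtain ⟨B, hBN, hB, hBS⟩ := exists_blocks_of_short hη N S (by
    rw [mul_comm N m]; omega)
  obtain ⟨hBc, T, hT3, hT, hTns⟩ := hrem B hB hBN hBS
  refine ⟨T, hT3, ?_, hTns⟩
  intro g hg
  rw [← add_tsub_cancel_of_le hBS, Multiset.mem_add] at hg
  rcases hg with hg | hg
  · obtain ⟨X, hXB, hgX⟩ : ∃ X ∈ B, g ∈ X := by
      exact Multiset.mem_join.1 hg
    obtain ⟨C, rfl⟩ := Multiset.exists_cons_of_mem hXB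
    have hCb : ∀ Y ∈ C, IsBlock π m Y := fun Y hY => hB Y (Multiset.mem_cons_of_mem hY)
    have hX := hB X hXB
    rw [Multiset.card_cons] at hBN
    rw [Multiset.sum_cons] at hBS hBc hT
    have hCc := card_sum_le_of_blocks hCb
    have e : m * N = m * C.card + m := by rw [← hBN]; ring
    have hXle := hX.card_le
    rw [Multiset.card_add] at hBc
    have hXc : X.card = m := by omega
    have hD : (S - C.sum).map π = X.map π + (m - 1) • T := by
      rw [← hT, ← Multiset.map_add]
      congr 1
      rw [add_comm X C.sum, ← tsub_tsub, add_tsub_cancel_of_le]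
      exact le_tsub_of_add_le_right hBS
    have hCS : C.sum ≤ S := (Multiset.le_add_left _ _).trans hBS
    refine mem_of_exchange hm hmH (X := X.map π) hT3 (by simpa using hXc)
      (by rw [← map_multiset_sum, hX.map_sum]) hη hTns ?_ _ (Multiset.mem_map_of_mem π hgX)
    intro U hU hU0 hUs hUc
    rw [← hD] at hU ⊢
    obtain ⟨Y, hY, rfl⟩ := Multiset.exists_le_map_eq hU
    rw [Multiset.card_map] at hUc
    have hblock : IsBlock π m Y :=
      ⟨by rintro rfl; exact hU0 rfl, hUc, by rw [map_multiset_sum, hUs]⟩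
    obtain ⟨h1, T', -, hT', -⟩ := hrem (Y ::ₘ C) (by
        intro Z hZ
        rcases Multiset.mem_cons.1 hZ with rfl | hZ
        · exact hblock
        · exact hCb Z hZ) (by rw [Multiset.card_cons, hBN]) (by
        rw [Multiset.sum_cons]
        calc Y + C.sum ≤ (S - C.sum) + C.sum := add_le_add_left hY _
          _ = S := tsub_add_cancel_of_le hCS)
    rw [Multiset.sum_cons] at h1 hT'
    rw [Multiset.card_add] at h1
    refine ⟨by rw [Multiset.card_map]; omega, T', ?_⟩
    rw [← hT', add_comm Y, ← tsub_tsub]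
    conv_lhs => rw [← add_tsub_cancel_of_le hY, Multiset.map_add]
    rw [add_tsub_cancel_left]
  · have : π g ∈ (m - 1) • T := hT ▸ Multiset.mem_map_of_mem π hg
    exact Multiset.mem_of_mem_nsmul this

/-- The three fibres of an extremal sequence over `t 0`, `t 1`, `t 2`. -/
structure IsFibration {G H : Type*} [AddCommGroup G] [AddCommGroup H] (π : G →+ H) (m n : ℕ)
    (F : Fin 3 → Multiset G) (t : Fin 3 → H) (k : Fin 3 → ℕ) : Prop where
  no_short : ∀ Q ≤ ∑ i, F i, Q ≠ 0 → Q.card ≤ m * n → Q.sum ≠ 0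
  map_eq : ∀ i, ∀ g ∈ F i, π g = t i
  card_eq : ∀ i, (F i).card = k i * m + (m - 1)
  sum_eq : ∑ i, k i + 1 = n

section Fibration

variable {G H : Type*} [AddCommGroup G] [AddCommGroup H] {π : G →+ H} {m n : ℕ}

lemma exists_blocks_of_fibres [DecidableEq G] (hm : 0 < m) (hmH : ∀ t : H, m • t = 0)
    {F V : Fin 3 → Multiset G} {t : Fin 3 → H} (hF : ∀ i, ∀ g ∈ F i, π g = t i)
    (hV : ∀ i, V i ≤ F i) :
    ∃ B : Multiset (Multiset G), B.card = ∑ i, ((F i).card - (V i).card) / m ∧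
      (∀ X ∈ B, IsBlock π m X) ∧ ∑ i, V i + B.sum ≤ ∑ i, F i := by
  have := fun i => exists_blocks_of_fibre (π := π) hm (hmH (t i))
    (((F i).card - (V i).card) / m) (F i - V i)
    (fun g hg => hF i g (Multiset.mem_of_le (Multiset.sub_le_self _ _) hg))
    (by rw [Multiset.card_sub (hV i)]; exact Nat.div_mul_le_self _ _)
  choose B hB1 hB2 hB3 using this
  refine ⟨∑ i, B i, ?_, ?_, ?_⟩
  · rw [Multiset.card_sum]
    exact Finset.sum_congr rfl fun i _ => hB1 i
  · intro X hX
    rw [Multiset.mem_sum] at hX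
    obtain ⟨i, -, hX⟩ := hX
    exact hB2 i X hX
  · have : (∑ i, B i).sum = ∑ i, (B i).sum := map_sum Multiset.sumAddMonoidHom _ _
    rw [this, ← Finset.sum_add_distrib]
    refine Finset.sum_le_sum fun i _ => ?_
    calc V i + (B i).sum ≤ V i + (F i - V i) := add_le_add_right (hB3 i) _
      _ = F i := add_tsub_cancel_of_le (hV i)

lemma exists_fibration [DecidableEq H] (hm : 2 ≤ m) (hn : 0 < n) (hmH : ∀ t : H, m • t = 0)
    (hK : Nat.card π.ker = n) {S : Multiset G} (hSc : S.card = 2 * m + m * n - 3)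
    (hS : ∀ Q ≤ S, Q ≠ 0 → Q.card ≤ m * n → Q.sum ≠ 0) {t : Fin 3 → H}
    (ht : Function.Injective t) (hsupp : ∀ g ∈ S, ∃ i, π g = t i) :
    ∃ (F : Fin 3 → Multiset G) (k : Fin 3 → ℕ), S = ∑ i, F i ∧ IsFibration π m n F t k := by
  classical
  let F : Fin 3 → Multiset G := fun i => S.filter fun g => π g = t i
  have hFS : S = ∑ i, F i := by
    ext g
    rw [Multiset.count_sum']
    simp only [F, Multiset.count_filter]
    by_cases hg : g ∈ S
    · obtain ⟨i, hi⟩ := hsupp g hg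
      rw [Finset.sum_eq_single i]
      · simp [hi]
      · intro j _ hj
        rw [if_neg]
        rw [hi]
        exact fun h => hj (ht h).symm
      · simp
    · simp [Multiset.count_eq_zero.2 hg]
  have hmap : ∀ i, ∀ g ∈ F i, π g = t i := fun i g hg => (Multiset.mem_filter.1 hg).2
  obtain ⟨B, hBc, hB, hBS⟩ := exists_blocks_of_fibres (V := fun _ => 0) (by omega) hmH hmap
    (fun i => Multiset.zero_le _)
  have hlt := card_blocks_lt hn hK hS hB (by rw [hFS]; simpa using hBS)
  rw [hBc] at hlt
  have hcards : (F 0).card + (F 1).card + (F 2).card = 2 * m + m * n - 3 := by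
    rw [← hSc, hFS, Multiset.card_sum, Fin.sum_univ_three]
  simp only [Fin.sum_univ_three, Multiset.card_zero, Nat.sub_zero] at hlt
  have d : ∀ i, (F i).card = (F i).card / m * m + (F i).card % m ∧ (F i).card % m < m := fun i =>
    ⟨by rw [mul_comm]; exact (Nat.div_add_mod _ _).symm, Nat.mod_lt _ (by omega)⟩
  have d0 := d 0
  have d1 := d 1
  have d2 := d 2
  have key : (F 0).card / m + (F 1).card / m + (F 2).card / m + 1 = n := by
    by_contra hne
    have h1 : (F 0).card / m + (F 1).card / m + (F 2).card / m + 2 ≤ n := by omega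
    have h2 := Nat.mul_le_mul_left m h1
    have h3 : m * ((F 0).card / m + (F 1).card / m + (F 2).card / m + 2) =
      (F 0).card / m * m + (F 1).card / m * m + (F 2).card / m * m + 2 * m := by ring
    omega
  have key2 : (F 0).card / m * m + (F 1).card / m * m + (F 2).card / m * m + m = m * n := by
    rw [← key]; ring
  refine ⟨F, fun i => (F i).card / m, hFS, ?_, hmap, ?_, ?_⟩
  · rwa [← hFS]
  · intro i
    have := d i
    fin_cases i
    · simp only [Fin.zero_eta] at *; omega
    · simp only [Fin.mk_one] at *; omega
    · simp only [Fin.reduceFinMk] at *; omega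
  · rw [Fin.sum_univ_three]; exact key

namespace IsFibration

variable {F : Fin 3 → Multiset G} {t : Fin 3 → H} {k : Fin 3 → ℕ}

lemma map_sum_eq (hF : IsFibration π m n F t k) {X : Fin 3 → Multiset G} (hX : ∀ i, X i ≤ F i) :
    π (∑ i, X i).sum = ∑ i, (X i).card • t i := by
  rw [show (∑ i, X i).sum = ∑ i, (X i).sum from map_sum Multiset.sumAddMonoidHom _ _, map_sum]
  refine Finset.sum_congr rfl fun i _ => ?_
  have : (X i).map π = Multiset.replicate (X i).card (t i) := by
    rw [Multiset.eq_replicate]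
    refine ⟨by simp, fun b hb => ?_⟩
    rw [Multiset.mem_map] at hb
    obtain ⟨g, hg, rfl⟩ := hb
    exact hF.map_eq i g (Multiset.mem_of_le (hX i) hg)
  rw [map_multiset_sum, this, Multiset.sum_replicate]

lemma sum_eq_sum (hF : IsFibration π m n F t k) (hm : 2 ≤ m) (hmH : ∀ t : H, m • t = 0)
    (hK : Nat.card π.ker = n) {V W W' : Fin 3 → Multiset G}
    (i : Fin 3) (hV : ∀ j, V j ≤ F j) (hVi : (V i).card ≤ m)
    (hVj : ∀ j, j ≠ i → (V j).card ≤ m - 1) (hW : ∀ j, W j ≤ V j) (hW' : ∀ j, W' j ≤ V j)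
    (hW0 : 0 < ∑ j, (W j).card) (hW'0 : 0 < ∑ j, (W' j).card)
    (hWc : ∑ j, (W j).card ≤ 2 * m) (hW'c : ∑ j, (W' j).card ≤ 2 * m)
    (hWπ : ∑ j, (W j).card • t j = 0) (hW'π : ∑ j, (W' j).card • t j = 0) :
    ∑ j, (W j).sum = ∑ j, (W' j).sum := by
  classical
  obtain ⟨B, hBc, hB, hBS⟩ := exists_blocks_of_fibres (by omega) hmH hF.map_eq hV
  have hn := hF.sum_eq
  have hBn : n ≤ B.card + 2 := by
    have e1 : ∀ j, j ≠ i → k j ≤ ((F j).card - (V j).card) / m := by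
      intro j hj
      have := hVj j hj
      have := hF.card_eq j
      rw [Nat.le_div_iff_mul_le (by omega)]
      omega
    have e2 : k i - 1 ≤ ((F i).card - (V i).card) / m := by
      have := hF.card_eq i
      rw [Nat.le_div_iff_mul_le (by omega), Nat.sub_mul]
      omega
    rw [hBc, ← hn, Fin.sum_univ_three, Fin.sum_univ_three]
    fin_cases i
    · have := e1 1 (by decide)
      have := e1 2 (by decide)
      simp only [Fin.zero_eta] at *; omega
    · have := e1 0 (by decide)
      have := e1 2 (by decide)
      simp only [Fin.mk_one] at *; omega
    · have := e1 0 (by decide)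
      have := e1 1 (by decide)
      simp only [Fin.reduceFinMk] at *; omega
  have hs : ∀ X : Fin 3 → Multiset G, (∑ i, X i).sum = ∑ i, (X i).sum :=
    fun X => map_sum Multiset.sumAddMonoidHom _ _
  rw [← hs, ← hs]
  have hpos : ∀ X : Fin 3 → Multiset G, 0 < ∑ j, (X j).card → ∑ j, X j ≠ 0 := by
    intro X hX h
    rw [← Multiset.card_sum, h] at hX
    simp at hX
  exact sum_eq_sum_of_blocks (by omega) hK hF.no_short hB hBS hBn
    (Finset.sum_le_sum fun j _ => hW j) (Finset.sum_le_sum fun j _ => hW' j)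
    (hpos W hW0) (hpos W' hW'0)
    (by rwa [Multiset.card_sum]) (by rwa [Multiset.card_sum])
    (by rw [hF.map_sum_eq fun j => (hW j).trans (hV j), hWπ])
    (by rw [hF.map_sum_eq fun j => (hW' j).trans (hV j), hW'π])

lemma eq_of_mem (hF : IsFibration π m n F t k) (hm : 2 ≤ m) (hmH : ∀ t : H, m • t = 0)
    (hK : Nat.card π.ker = n) {w : Fin 3 → ℕ} {i : Fin 3} (hwi : w i = 1)
    (hw : ∀ j, w j ≤ m - 1) (hws : ∑ j, w j ≤ 2 * m) (hwt : ∑ j, w j • t j = 0)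
    {u v : G} (hu : u ∈ F i) (hv : v ∈ F i) : u = v := by
  classical
  by_contra huv
  have huvF : ({u, v} : Multiset G) ≤ F i := by
    rw [Multiset.insert_eq_cons, Multiset.cons_le_of_notMem (by simpa using huv)]
    exact ⟨hu, by simpa using hv⟩
  have : ∀ j, ∃ Y ≤ F j, Y.card = w j := fun j =>
    Multiset.exists_le_card_eq_of_le (by rw [hF.card_eq j]; exact (hw j).trans (Nat.le_add_left _ _))
  choose Y hY hYc using this
  have hcard : ∀ g j, (Function.update Y i {g} j).card = w j := by
    intro g j
    by_cases hj : j = i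
    · subst hj; simp [hwi]
    · simp [hj, hYc]
  have hle : ∀ g ∈ ({u, v} : Multiset G), ∀ j,
      Function.update Y i {g} j ≤ Function.update Y i {u, v} j := by
    intro g hg j
    by_cases hj : j = i
    · subst hj; simpa using hg
    · simp [hj]
  have hpos : 0 < ∑ j, w j := by
    have := Finset.single_le_sum (f := w) (fun j _ => Nat.zero_le _) (Finset.mem_univ i)
    omega
  have key := hF.sum_eq_sum hm hmH hK (V := Function.update Y i {u, v})
    (W := Function.update Y i {u}) (W' := Function.update Y i {v}) i
    (by
      intro j
      by_cases hj : j = i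
      · subst hj; simpa using huvF
      · simpa [hj] using hY j)
    (by simpa using hm)
    (by
      intro j hj
      simpa [hj, hYc] using hw j)
    (hle u (by simp)) (hle v (by simp))
    (by simpa only [hcard] using hpos) (by simpa only [hcard] using hpos)
    (by simpa only [hcard] using hws) (by simpa only [hcard] using hws)
    (by simpa only [hcard] using hwt) (by simpa only [hcard] using hwt)
  have hupd : ∀ g : G, ∑ j, (Function.update Y i {g} j).sum =
      g + ∑ j ∈ Finset.univ \ {i}, (Y j).sum := by
    intro g
    have : (fun j => (Function.update Y i {g} j).sum) =
        Function.update (fun j => (Y j).sum) i g := by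
      funext j
      by_cases hj : j = i
      · subst hj; simp
      · simp [hj]
    rw [this, Finset.sum_update_of_mem (Finset.mem_univ i)]
  rw [hupd, hupd, add_left_inj] at key
  exact huv key

lemma combination_eq (hF : IsFibration π m n F t k) (hm : 2 ≤ m) (hmH : ∀ t : H, m • t = 0)
    (hK : Nat.card π.ker = n) {f : Fin 3 → G}
    (hf : ∀ j, F j = Multiset.replicate (k j * m + (m - 1)) (f j))
    {c w w' : Fin 3 → ℕ} (i : Fin 3) (hc : ∀ j, c j ≤ k j * m + (m - 1)) (hci : c i ≤ m)
    (hcj : ∀ j, j ≠ i → c j ≤ m - 1) (hw : ∀ j, w j ≤ c j) (hw' : ∀ j, w' j ≤ c j)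
    (hw0 : 0 < ∑ j, w j) (hw'0 : 0 < ∑ j, w' j) (hws : ∑ j, w j ≤ 2 * m)
    (hw's : ∑ j, w' j ≤ 2 * m) (hwt : ∑ j, w j • t j = 0) (hw't : ∑ j, w' j • t j = 0) :
    ∑ j, w j • f j = ∑ j, w' j • f j := by
  have := hF.sum_eq_sum hm hmH hK (V := fun j => Multiset.replicate (c j) (f j))
    (W := fun j => Multiset.replicate (w j) (f j)) (W' := fun j => Multiset.replicate (w' j) (f j))
    i (fun j => by rw [hf j]; exact Multiset.replicate_le_replicate _ |>.2 (hc j))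
    (by simpa using hci) (fun j hj => by simpa using hcj j hj)
    (fun j => Multiset.replicate_le_replicate _ |>.2 (hw j))
    (fun j => Multiset.replicate_le_replicate _ |>.2 (hw' j))
    (by simpa using hw0) (by simpa using hw'0) (by simpa using hws) (by simpa using hw's)
    (by simpa using hwt) (by simpa using hw't)
  simpa using this

lemma nsmul_ne_zero (hF : IsFibration π m n F t k) (hm : 2 ≤ m) {f : Fin 3 → G}
    (hf : ∀ j, F j = Multiset.replicate (k j * m + (m - 1)) (f j)) {h : G}
    (hh : ∀ j, 0 < k j → m • f j = h) {l : ℕ} (hl : 0 < l) (hln : l < n) : l • h ≠ 0 := by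
  have hn := hF.sum_eq
  rw [Fin.sum_univ_three] at hn
  obtain ⟨q, hq, hql⟩ : ∃ q : Fin 3 → ℕ, (∀ j, q j ≤ k j) ∧ ∑ j, q j = l := by
    refine ⟨![min l (k 0), min (l - min l (k 0)) (k 1),
      l - min l (k 0) - min (l - min l (k 0)) (k 1)], ?_, ?_⟩
    · intro j
      fin_cases j
      · simp
      · simp
      · simp; omega
    · simp [Fin.sum_univ_three]
  have key := hF.no_short (∑ j, Multiset.replicate (q j * m) (f j))
    (Finset.sum_le_sum fun j _ => by
      rw [hf j, Multiset.replicate_le_replicate]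
      exact (Nat.mul_le_mul_right m (hq j)).trans (Nat.le_add_right _ _))
    (by
      intro h0
      have := congrArg Multiset.card h0
      simp only [Multiset.card_sum, Multiset.card_replicate, ← Finset.sum_mul, hql,
        Multiset.card_zero] at this
      rw [Nat.mul_eq_zero] at this
      omega)
    (by
      simp only [Multiset.card_sum, Multiset.card_replicate, ← Finset.sum_mul, hql]
      rw [mul_comm]
      exact Nat.mul_le_mul_left _ hln.le)
  have e : (∑ j, Multiset.replicate (q j * m) (f j)).sum = l • h := by
    have hs : ∀ X : Fin 3 → Multiset G, (∑ i, X i).sum = ∑ i, (X i).sum :=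
      fun X => map_sum Multiset.sumAddMonoidHom _ _
    rw [hs fun j => Multiset.replicate (q j * m) (f j), ← hql, Finset.sum_smul]
    refine Finset.sum_congr rfl fun j _ => ?_
    rw [Multiset.sum_replicate, mul_nsmul']
    rcases Nat.eq_zero_or_pos (q j) with h0 | h0
    · simp [h0]
    · rw [hh j (h0.trans_le (hq j))]
  rwa [e] at key

end IsFibration

end Fibration

/-- The two shapes of an extremal sequence. -/
def IsExtremal {G : Type*} [AddCommGroup G] (m n : ℕ) (S : Multiset G) : Prop :=
  (∃ (e1 e2 : G) (x : ℤ) (s : ℕ),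
    (∀ a b : ℤ, a • e1 + b • e2 = 0 → a • e1 = 0 ∧ b • e2 = 0) ∧
    AddSubgroup.closure ({e1, e2} : Set G) = ⊤ ∧
    addOrderOf e2 = m * n ∧ Int.gcd x m = 1 ∧ 1 ≤ s ∧ s ≤ n ∧
    S = Multiset.replicate (m - 1) e1 + Multiset.replicate (s * m - 1) e2 +
          Multiset.replicate ((n + 1 - s) * m - 1) ((-x) • e1 + e2)) ∨
  (∃ g1 g2 : G,
    AddSubgroup.closure ({g1, g2} : Set G) = ⊤ ∧
    addOrderOf g2 = m * n ∧
    S = Multiset.replicate (m - 1) g1 + Multiset.replicate (m * n - 1) g2 +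
          Multiset.replicate (m - 1) (-g1 + g2))

section Extremal

variable {G H : Type*} [AddCommGroup G] [AddCommGroup H] {π : G →+ H} {m n : ℕ}

lemma closure_pair_eq_top (hm : 0 < m) (hn : 0 < n) (hmH : ∀ t : H, m • t = 0)
    (hcard : Nat.card H = m * m) (hK : Nat.card π.ker = n) {e1 e2 : G}
    (hns : ∀ a b : ℕ, a < m → b < m → a • π e1 + b • π e2 = 0 → a + b ≤ m → a = 0 ∧ b = 0)
    (ho : addOrderOf (m • e2) = n) : AddSubgroup.closure ({e1, e2} : Set G) = ⊤ := by
  have : Finite π.ker := Nat.finite_of_card_ne_zero (by omega)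
  have hz : AddSubgroup.zmultiples (m • e2) = π.ker := by
    refine AddSubgroup.eq_of_le_of_card_ge ?_ ?_
    · rw [AddSubgroup.zmultiples_le, AddMonoidHom.mem_ker, map_nsmul, hmH]
    · rw [hK, Nat.card_zmultiples, ho]
  rw [eq_top_iff]
  intro g _
  obtain ⟨a, b, -, -, hab⟩ := exists_combination hm hmH hcard hns (π g)
  have hg : g - (a • e1 + b • e2) ∈ AddSubgroup.zmultiples (m • e2) := by
    rw [hz, AddMonoidHom.mem_ker, map_sub, map_add, map_nsmul, map_nsmul, hab, sub_self]
  obtain ⟨z, hz⟩ := AddSubgroup.mem_zmultiples_iff.1 hg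
  have h1 : e1 ∈ AddSubgroup.closure ({e1, e2} : Set G) := AddSubgroup.subset_closure (by simp)
  have h2 : e2 ∈ AddSubgroup.closure ({e1, e2} : Set G) := AddSubgroup.subset_closure (by simp)
  rw [eq_sub_iff_add_eq] at hz
  rw [← hz]
  exact add_mem (zsmul_mem (nsmul_mem h2 _) _) (add_mem (nsmul_mem h1 _) (nsmul_mem h2 _))

lemma addOrderOf_eq_mul (hm : 0 < m) {e : G} (hns : ∀ b : ℕ, b < m → b • π e = 0 → b = 0)
    (hmH : ∀ t : H, m • t = 0) (ho : addOrderOf (m • e) = n) : addOrderOf e = m * n := by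
  apply Nat.dvd_antisymm
  · rw [addOrderOf_dvd_iff_nsmul_eq_zero, mul_nsmul, ← ho, addOrderOf_nsmul_eq_zero]
  · have h0 : addOrderOf e • e = 0 := addOrderOf_nsmul_eq_zero e
    have h1 : addOrderOf e • π e = 0 := by rw [← map_nsmul, h0, map_zero]
    rw [← mod_nsmul_of_nsmul_eq_zero (hmH _)] at h1
    obtain ⟨q, hq⟩ := Nat.dvd_of_mod_eq_zero (hns _ (Nat.mod_lt _ hm) h1)
    rw [hq, mul_nsmul, ← addOrderOf_dvd_iff_nsmul_eq_zero, ho] at h0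
    rw [hq]
    exact Nat.mul_dvd_mul_left _ h0

lemma zsmul_pair_independent (hm : 0 < m) (hmH : ∀ t : H, m • t = 0) {e1 e2 : G}
    (hns : ∀ a b : ℕ, a < m → b < m → a • π e1 + b • π e2 = 0 → a + b ≤ m → a = 0 ∧ b = 0)
    (h1 : m • e1 = 0) (a b : ℤ) (h : a • e1 + b • e2 = 0) : a • e1 = 0 ∧ b • e2 = 0 := by
  have hm' : (m : ℤ) ≠ 0 := by omega
  have hred : ∀ (z : ℤ) (t : H), z • t = (z % m).toNat • t := by
    intro z t
    rw [← natCast_zsmul, Int.toNat_of_nonneg (Int.emod_nonneg _ hm')]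
    conv_lhs => rw [← Int.emod_add_mul_ediv z m, add_zsmul, mul_comm, mul_zsmul, natCast_zsmul, hmH,
      zsmul_zero, add_zero]
  have hlt : ∀ z : ℤ, (z % m).toNat < m := by
    intro z
    have := Int.emod_lt_of_pos z (show (0 : ℤ) < m by omega)
    omega
  have hπ : a • π e1 + b • π e2 = 0 := by rw [← map_zsmul, ← map_zsmul, ← map_add, h, map_zero]
  rw [hred a, hred b] at hπ
  have h0 := (pair_independent hmH hns (hlt a) (hlt b) hπ).1
  have hd : (m : ℤ) ∣ a := Int.dvd_of_emod_eq_zero (by have := Int.emod_nonneg a hm'; omega)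
  obtain ⟨c, rfl⟩ := hd
  have : ((m : ℤ) * c) • e1 = 0 := by rw [mul_comm, mul_zsmul, natCast_zsmul, h1, zsmul_zero]
  exact ⟨this, by rwa [this, zero_add] at h⟩

lemma isExtremal_of_nsmul_eq_zero (hm : 0 < m) (hmH : ∀ t : H, m • t = 0)
    (hcard : Nat.card H = m * m) (hK : Nat.card π.ker = n) {e1 e2 : G}
    (hns : ∀ a b : ℕ, a < m → b < m → a • π e1 + b • π e2 = 0 → a + b ≤ m → a = 0 ∧ b = 0)
    (h1 : m • e1 = 0) (ho : addOrderOf (m • e2) = n) {x : ℤ} (hx : Int.gcd x m = 1)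
    {k l : ℕ} (hkl : k + l + 1 = n) :
    IsExtremal m n (Multiset.replicate (m - 1) e1 + Multiset.replicate (k * m + (m - 1)) e2 +
      Multiset.replicate (l * m + (m - 1)) ((-x) • e1 + e2)) := by
  refine Or.inl ⟨e1, e2, x, k + 1, fun a b => zsmul_pair_independent hm hmH hns h1 a b,
    closure_pair_eq_top hm (by omega) hmH hcard hK hns ho,
    addOrderOf_eq_mul (π := π) hm (fun b hb h => (hns 0 b hm hb (by simpa using h) (by omega)).2)
      hmH ho, hx, by omega, by omega, ?_⟩
  have e1 : (k + 1) * m - 1 = k * m + (m - 1) := by rw [add_mul]; omega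
  have e2 : (n + 1 - (k + 1)) * m - 1 = l * m + (m - 1) := by
    rw [show n + 1 - (k + 1) = l + 1 by omega, add_mul]; omega
  rw [e1, e2]

lemma isExtremal_of_generators (hm : 0 < m) (hmH : ∀ t : H, m • t = 0)
    (hcard : Nat.card H = m * m) (hK : Nat.card π.ker = n) {e1 e2 : G}
    (hns : ∀ a b : ℕ, a < m → b < m → a • π e1 + b • π e2 = 0 → a + b ≤ m → a = 0 ∧ b = 0)
    (ho : addOrderOf (m • e2) = n) {k : ℕ} (hk : k + 1 = n) :
    IsExtremal m n (Multiset.replicate (m - 1) e1 + Multiset.replicate (k * m + (m - 1)) e2 +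
      Multiset.replicate (m - 1) (-e1 + e2)) := by
  refine Or.inr ⟨e1, e2, closure_pair_eq_top hm (by omega) hmH hcard hK hns ho,
    addOrderOf_eq_mul (π := π) hm (fun b hb h => (hns 0 b hm hb (by simpa using h) (by omega)).2)
      hmH ho, ?_⟩
  rw [show m * n - 1 = k * m + (m - 1) by rw [← hk, mul_add, mul_comm]; omega]

/-- The data extracted from an extremal sequence: three terms `f0`, `f1`, `f2` whose images admit
no short relation, with multiplicities governed by `k0`, `k1`, `k2`, such that all the zero-sum
relations lifted from the quotient have the same sum `h`. -/
structure IsConfig (π : G →+ H) (m n : ℕ) (f0 f1 f2 : G) (k0 k1 k2 x : ℕ) (h : G) : Prop where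
  no_short : ∀ a b c : ℕ, a < m → b < m → c < m → a • π f0 + b • π f1 + c • π f2 = 0 →
    a + b + c ≤ m → a = 0 ∧ b = 0 ∧ c = 0
  pos : 0 < x
  lt : x < m
  coprime : Nat.Coprime x m
  sum_eq : k0 + k1 + k2 + 1 = n
  order : addOrderOf h = n
  nsmul0 : 0 < k0 → m • f0 = h
  nsmul1 : 0 < k1 → m • f1 = h
  nsmul2 : 0 < k2 → m • f2 = h
  comb : ∀ γ, 0 < γ → γ < m → (x * γ % m) • f0 + (m - γ) • f1 + γ • f2 = h

namespace IsConfig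

variable {f0 f1 f2 h : G} {k0 k1 k2 x : ℕ}

lemma swap (hf : IsConfig π m n f0 f1 f2 k0 k1 k2 x h) :
    IsConfig π m n f0 f2 f1 k0 k2 k1 (m - x) h where
  no_short a b c ha hb hc h1 h2 := by
    have := hf.no_short a c b ha hc hb (by rw [← h1]; abel) (by omega)
    tauto
  pos := by have := hf.lt; omega
  lt := by have := hf.pos; have := hf.lt; omega
  coprime := (Nat.coprime_self_sub_left hf.lt.le).2 hf.coprime
  sum_eq := by have := hf.sum_eq; omega
  order := hf.order
  nsmul0 := hf.nsmul0
  nsmul1 := hf.nsmul2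
  nsmul2 := hf.nsmul1
  comb γ h0 h1 := by
    have := hf.comb (m - γ) (by omega) (by omega)
    rw [← this, Nat.sub_sub_self h1.le]
    have e : (m - x) * γ ≡ x * (m - γ) [MOD m] := by
      obtain ⟨y, hy⟩ := Nat.exists_eq_add_of_lt hf.lt
      obtain ⟨δ, hδ⟩ := Nat.exists_eq_add_of_lt h1
      rw [show m - x = y + 1 by omega, show m - γ = δ + 1 by omega]
      have h2 : (y + 1) * γ + x * (γ + (δ + 1)) = x * (δ + 1) + γ * (x + (y + 1)) := by ring
      rw [← add_assoc, ← hδ, ← add_assoc, ← hy] at h2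
      have h3 : (y + 1) * γ + x * m ≡ (y + 1) * γ [MOD m] := by simp [Nat.ModEq]
      have h4 : x * (δ + 1) + γ * m ≡ x * (δ + 1) [MOD m] := by simp [Nat.ModEq]
      exact h3.symm.trans (h2 ▸ h4)
    rw [e]
    abel

lemma isExtremal_of_nsmul (hf : IsConfig π m n f0 f1 f2 k0 k1 k2 x h) (hmH : ∀ t : H, m • t = 0)
    (hcard : Nat.card H = m * m) (hK : Nat.card π.ker = n) (h1 : m • f1 = h) :
    IsExtremal m n (Multiset.replicate (k0 * m + (m - 1)) f0 +
      Multiset.replicate (k1 * m + (m - 1)) f1 + Multiset.replicate (k2 * m + (m - 1)) f2) := by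
  have hx0 := hf.pos
  have hxm := hf.lt
  have hn := hf.sum_eq
  have ho : addOrderOf (m • f1) = n := h1 ▸ hf.order
  have hns01 : ∀ a b : ℕ, a < m → b < m → a • π f0 + b • π f1 = 0 → a + b ≤ m →
      a = 0 ∧ b = 0 := by
    intro a b ha hb h hab
    have := hf.no_short a b 0 ha hb (by omega) (by simpa using h) (by omega)
    tauto
  have hns21 : ∀ a b : ℕ, a < m → b < m → a • π f2 + b • π f1 = 0 → a + b ≤ m →
      a = 0 ∧ b = 0 := by
    intro a b ha hb h hab
    have := hf.no_short 0 b a (by omega) hb ha (by rw [← h]; simp [add_comm]) (by omega)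
    tauto
  have hh : 2 ≤ n → h ≠ 0 := by
    intro h2 h0
    have := hf.order
    rw [h0, addOrderOf_zero] at this
    omega
  have hf2 : f2 = (-(x : ℤ)) • f0 + f1 := by
    have e := hf.comb 1 one_pos (by omega)
    rw [mul_one, Nat.mod_eq_of_lt hxm, one_nsmul, ← h1] at e
    have e2 : m • f1 = (m - 1) • f1 + f1 := by
      rw [← succ_nsmul, Nat.sub_add_cancel (by omega)]
    rw [e2, add_comm (x • f0), add_assoc, add_right_inj] at e
    rw [neg_zsmul, natCast_zsmul, ← e]
    abel
  have hgcd : Int.gcd (x : ℤ) m = 1 := by simpa using hf.coprime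
  by_cases hx1 : x = 1
  · subst hx1
    rw [Nat.cast_one, neg_one_zsmul] at hf2
    rcases Nat.eq_zero_or_pos k0 with hk0 | hk0
    · subst hk0
      rcases Nat.eq_zero_or_pos k2 with hk2 | hk2
      · subst hk2
        have := isExtremal_of_generators (by omega) hmH hcard hK hns01 ho
          (show k1 + 1 = n by omega)
        rw [hf2]
        simpa using this
      · have h0 : m • f0 = 0 := by
          have := hf.nsmul2 hk2
          rw [hf2, nsmul_add, h1, smul_neg] at this
          simpa using this
        have := isExtremal_of_nsmul_eq_zero (by omega) hmH hcard hK hns01 h0 ho hgcd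
          (show k1 + k2 + 1 = n by omega)
        rw [hf2]
        simpa using this
    · have h2 : m • f2 = 0 := by
        rw [hf2, nsmul_add, h1, smul_neg, hf.nsmul0 hk0, neg_add_cancel]
      have hk2 : k2 = 0 := by
        by_contra hk2
        exact hh (by omega) ((hf.nsmul2 (by omega)).symm.trans h2)
      subst hk2
      have := isExtremal_of_nsmul_eq_zero (by omega) hmH hcard hK hns21 h2 ho hgcd
        (show k1 + k0 + 1 = n by omega)
      have e : (-((1 : ℕ) : ℤ)) • f2 + f1 = f0 := by
        rw [hf2, Nat.cast_one, neg_one_zsmul]; abel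
      rw [e] at this
      convert this using 1
      rw [zero_mul, zero_add]
      abel
  · have h0 : m • f0 = 0 := by
      have hr := Nat.mod_lt m (show x > 0 by omega)
      have hd := Nat.div_add_mod m x
      have hdle : m / x ≤ m / 2 := Nat.div_le_div_left (by omega) (by omega)
      have e := hf.comb (m / x + 1) (Nat.succ_pos _) (by omega)
      have e1 : x * (m / x + 1) = m + (x - m % x) := by rw [mul_add]; omega
      have e2 : x * (m / x + 1) % m = x - m % x := by
        rw [e1, Nat.add_mod_left, Nat.mod_eq_of_lt (by omega)]
      rw [e2, hf2, nsmul_add, neg_zsmul, natCast_zsmul, smul_neg, ← mul_nsmul, e1, ← h1] at e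
      have e3 : m • f1 = (m - (m / x + 1)) • f1 + (m / x + 1) • f1 := by
        rw [← add_nsmul, Nat.sub_add_cancel (by omega)]
      rw [e3, add_nsmul] at e
      rw [← neg_eq_zero, ← sub_eq_zero.2 e]
      abel
    have hk0 : k0 = 0 := by
      by_contra hk0
      exact hh (by omega) ((hf.nsmul0 (by omega)).symm.trans h0)
    subst hk0
    have := isExtremal_of_nsmul_eq_zero (by omega) hmH hcard hK hns01 h0 ho hgcd
      (show k1 + k2 + 1 = n by omega)
    rw [hf2]
    simpa using this

lemma nsmul_eq_of_two_mul_lt (hf : IsConfig π m n f0 f1 f2 k0 k1 k2 x h) (hx : 2 * x < m) :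
    m • f1 = h := by
  have hx0 := hf.pos
  have e1 := hf.comb 1 one_pos (by omega)
  have e2 := hf.comb 2 two_pos (by omega)
  rw [mul_one, Nat.mod_eq_of_lt (by omega), one_nsmul] at e1
  rw [Nat.mod_eq_of_lt (by omega), mul_two, add_nsmul, two_nsmul] at e2
  have e3 : (m - 1) • f1 = (m - 2) • f1 + f1 := by
    rw [← succ_nsmul]; congr 1; omega
  have e4 : m • f1 = (m - 2) • f1 + f1 + f1 := by
    rw [← succ_nsmul, ← succ_nsmul]; congr 1; omega
  rw [e3] at e1
  rw [e4]
  have e5 : (m - 2) • f1 + f1 + f1 =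
      (x • f0 + ((m - 2) • f1 + f1) + f2) + (x • f0 + ((m - 2) • f1 + f1) + f2) -
        (x • f0 + x • f0 + (m - 2) • f1 + (f2 + f2)) := by abel
  rw [e5, e1, e2]
  abel

lemma isExtremal (hf : IsConfig π m n f0 f1 f2 k0 k1 k2 x h) (hmH : ∀ t : H, m • t = 0)
    (hcard : Nat.card H = m * m) (hK : Nat.card π.ker = n) :
    IsExtremal m n (Multiset.replicate (k0 * m + (m - 1)) f0 +
      Multiset.replicate (k1 * m + (m - 1)) f1 + Multiset.replicate (k2 * m + (m - 1)) f2) := by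
  have hx0 := hf.pos
  have hxm := hf.lt
  have hn := hf.sum_eq
  by_cases h1 : m • f1 = h
  · exact hf.isExtremal_of_nsmul hmH hcard hK h1
  by_cases h2 : m • f2 = h
  · rw [add_right_comm]
    exact hf.swap.isExtremal_of_nsmul hmH hcard hK h2
  have hk1 : k1 = 0 := by
    by_contra hk; exact h1 (hf.nsmul1 (by omega))
  have hk2 : k2 = 0 := by
    by_contra hk; exact h2 (hf.nsmul2 (by omega))
  have hx1 : ¬ 2 * x < m := fun hx => h1 (hf.nsmul_eq_of_two_mul_lt hx)
  have hx2 : ¬ 2 * (m - x) < m := fun hx => h2 (hf.swap.nsmul_eq_of_two_mul_lt hx)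
  have hm2 : m = 2 := by
    have e : m = 2 * x := by omega
    have := hf.coprime
    rw [e, Nat.Coprime, Nat.gcd_eq_left (dvd_mul_left x 2)] at this
    omega
  have hx : x = 1 := by omega
  have hk0 : 0 < k0 := by
    rw [Nat.pos_iff_ne_zero]
    rintro rfl
    have hn1 : n = 1 := by omega
    have hker : π.ker = ⊥ := AddSubgroup.card_eq_one.1 (hK.trans hn1)
    have hh : h = 0 := by
      have := hf.order
      rwa [hn1, AddMonoid.addOrderOf_eq_one_iff] at this
    apply h1
    have : m • f1 ∈ π.ker := by rw [AddMonoidHom.mem_ker, map_nsmul, hmH]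
    rw [hker, AddSubgroup.mem_bot] at this
    rw [this, hh]
  have hf2 : f2 = -f1 + f0 := by
    have e := hf.comb 1 one_pos (by omega)
    rw [← hf.nsmul0 hk0] at e
    subst hm2 hx
    simp only [Nat.mul_one, Nat.one_mod, one_nsmul, Nat.add_one_sub_one, two_nsmul] at e
    rw [add_assoc, add_right_inj] at e
    rw [← e]; abel
  have ho : addOrderOf (m • f0) = n := hf.nsmul0 hk0 ▸ hf.order
  have := isExtremal_of_generators (by omega) hmH hcard hK (e1 := f1) (e2 := f0) (by
    intro a b ha hb h hab
    have := hf.no_short b a 0 hb ha (by omega) (by rw [← h]; simp [add_comm]) (by omega)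
    tauto) ho (show k0 + 1 = n by omega)
  rw [hk1, hk2, hf2]
  convert this using 1
  rw [zero_mul, zero_add]
  abel

end IsConfig

end Extremal

lemma vec_three_injective {α : Type*} {u v w : α} (huv : u ≠ v) (huw : u ≠ w) (hvw : v ≠ w) :
    Function.Injective ![u, v, w] := by
  intro i j hij
  fin_cases i <;> fin_cases j <;> simp_all

section Main

variable {G H : Type*} [AddCommGroup G] [AddCommGroup H] {π : G →+ H} {m n : ℕ}

lemma eq_zero_of_triple_sum_eq_zero {u v w : H}
    (hT : ∀ U ≤ (m - 1) • ({u, v, w} : Multiset H), U ≠ 0 → U.sum = 0 → m < U.card)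
    {a b c : ℕ} (ha : a < m) (hb : b < m) (hc : c < m) (h : a • u + b • v + c • w = 0)
    (habc : a + b + c ≤ m) : a = 0 ∧ b = 0 ∧ c = 0 := by
  by_contra hne
  have hle : Multiset.replicate a u + Multiset.replicate b v + Multiset.replicate c w ≤
      (m - 1) • ({u, v, w} : Multiset H) := by
    have e : (m - 1) • ({u, v, w} : Multiset H) = Multiset.replicate (m - 1) u +
        Multiset.replicate (m - 1) v + Multiset.replicate (m - 1) w := by
      rw [Multiset.insert_eq_cons, Multiset.insert_eq_cons, ← Multiset.singleton_add,
        ← Multiset.singleton_add, ← add_assoc, nsmul_add, nsmul_add, Multiset.nsmul_singleton,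
        Multiset.nsmul_singleton, Multiset.nsmul_singleton]
    rw [e]
    exact add_le_add (add_le_add ((Multiset.replicate_le_replicate _).2 (by omega))
      ((Multiset.replicate_le_replicate _).2 (by omega)))
      ((Multiset.replicate_le_replicate _).2 (by omega))
  have := hT _ hle (by
    intro h0
    have := congrArg Multiset.card h0
    simp at this
    omega) (by simpa using h)
  simp at this
  omega

lemma exists_isConfig (hm : 2 ≤ m) (hn : 0 < n) (hmH : ∀ t : H, m • t = 0)
    (hcard : Nat.card H = m * m) (hK : Nat.card π.ker = n)
    (hC : ∀ S : Multiset H, S.card = 3 * m - 3 →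
      (¬ ∃ U ≤ S, U ≠ 0 ∧ U.sum = 0 ∧ Multiset.card U ≤ m) →
      ∃ T : Multiset H, T.card = 3 ∧ S = (m - 1) • T)
    {S : Multiset G} (hSc : S.card = 2 * m + m * n - 3)
    (hS : ∀ Q ≤ S, Q ≠ 0 → Q.card ≤ m * n → Q.sum ≠ 0) :
    ∃ (f0 f1 f2 h : G) (k0 k1 k2 x : ℕ), IsConfig π m n f0 f1 f2 k0 k1 k2 x h ∧
      S = Multiset.replicate (k0 * m + (m - 1)) f0 + Multiset.replicate (k1 * m + (m - 1)) f1 +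
        Multiset.replicate (k2 * m + (m - 1)) f2 := by
  classical
  obtain ⟨T, hT3, hST, hT⟩ := exists_support hm hn hmH hcard hK hC hSc hS
  obtain ⟨r, s, t, rfl⟩ := Multiset.card_eq_three.1 hT3
  obtain ⟨u, v, w, x, hrst, hx0, hxm, hxc, hv⟩ := exists_labelling hm hmH hcard
    (fun a b c ha hb hc => eq_zero_of_triple_sum_eq_zero hT ha hb hc)
  rw [hrst] at hT hST
  have hns : ∀ a b c : ℕ, a < m → b < m → c < m → a • u + b • v + c • w = 0 → a + b + c ≤ m →
      a = 0 ∧ b = 0 ∧ c = 0 := fun a b c ha hb hc => eq_zero_of_triple_sum_eq_zero hT ha hb hc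
  have hone : ∀ t : H, 1 • t + (m - 1) • t = 0 := by
    intro t
    rw [← add_nsmul, Nat.add_sub_cancel' (by omega), hmH]
  have huv : u ≠ v := by
    rintro rfl
    have := hns 1 (m - 1) 0 (by omega) (by omega) (by omega) (by simpa using hone u) (by omega)
    omega
  have huw : u ≠ w := by
    rintro rfl
    have := hns 1 0 (m - 1) (by omega) (by omega) (by omega) (by simpa using hone u) (by omega)
    omega
  have hvw : v ≠ w := by
    rintro rfl
    have := hns 0 1 (m - 1) (by omega) (by omega) (by omega) (by simpa using hone v) (by omega)
    omega
  have hinj := vec_three_injective huv huw hvw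
  have hrange : ∀ g ∈ S, ∃ i, π g = ![u, v, w] i := by
    intro g hg
    have := hST g hg
    simp only [Multiset.insert_eq_cons, Multiset.mem_cons, Multiset.mem_singleton] at this
    rcases this with h | h | h
    exacts [⟨0, h⟩, ⟨1, h⟩, ⟨2, h⟩]
  obtain ⟨F, k, hSF, hF⟩ := exists_fibration hm hn hmH hK hSc hS hinj hrange
  have hrel : ∀ γ, γ < m →
      ∑ j, (![x * γ % m, m - γ, γ] : Fin 3 → ℕ) j • (![u, v, w] : Fin 3 → H) j = 0 := by
    intro γ hγ
    have e : γ • v = γ • w + (x * γ) • u := by rw [← hv, nsmul_add, mul_nsmul]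
    have e2 := hmH v
    rw [← Nat.sub_add_cancel hγ.le, add_nsmul, e] at e2
    simp only [Fin.sum_univ_three, Matrix.cons_val_zero, Matrix.cons_val_one, Matrix.cons_val]
    rw [mod_nsmul_of_nsmul_eq_zero (hmH u), ← e2]
    abel
  have hmod : ∀ a, a % m < m := fun a => Nat.mod_lt _ (by omega)
  have hle : ∀ γ, 0 < γ → γ < m → ∀ j, (![x * γ % m, m - γ, γ] : Fin 3 → ℕ) j ≤ m - 1 := by
    intro γ h0 h1 j
    have := hmod (x * γ)
    fin_cases j <;> simp <;> omega
  have hsum : ∀ γ, γ < m → 0 < ∑ j, (![x * γ % m, m - γ, γ] : Fin 3 → ℕ) j ∧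
      ∑ j, (![x * γ % m, m - γ, γ] : Fin 3 → ℕ) j ≤ 2 * m := by
    intro γ h1
    have := hmod (x * γ)
    simp only [Fin.sum_univ_three, Matrix.cons_val_zero, Matrix.cons_val_one, Matrix.cons_val]
    omega
  have hconst : ∀ i, ∃ γ, 0 < γ ∧ γ < m ∧ (![x * γ % m, m - γ, γ] : Fin 3 → ℕ) i = 1 := by
    intro i
    fin_cases i
    · obtain ⟨y, hym, hy⟩ := Nat.exists_mul_mod_eq_one_of_coprime hxc (by omega)
      refine ⟨y, ?_, hym, hy⟩
      rw [Nat.pos_iff_ne_zero]; rintro rfl; simp at hy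
    · exact ⟨m - 1, by omega, by omega, show m - (m - 1) = 1 by omega⟩
    · exact ⟨1, one_pos, by omega, rfl⟩
  have hrep : ∀ i, ∃ f, F i = Multiset.replicate (k i * m + (m - 1)) f := by
    intro i
    have hc := hF.card_eq i
    obtain ⟨f, hf⟩ := Multiset.card_pos_iff_exists_mem.1 (show 0 < (F i).card by omega)
    obtain ⟨γ, h0, h1, h2⟩ := hconst i
    exact ⟨f, Multiset.eq_replicate.2 ⟨hc, fun b hb =>
      hF.eq_of_mem hm hmH hK h2 (hle γ h0 h1) (hsum γ h1).2 (hrel γ h1) hb hf⟩⟩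
  choose f hf using hrep
  have hcomb : ∀ γ, 0 < γ → γ < m →
      ∑ j, (![x * γ % m, m - γ, γ] : Fin 3 → ℕ) j • f j =
        ∑ j, (![x * 1 % m, m - 1, 1] : Fin 3 → ℕ) j • f j := by
    intro γ h0 h1
    exact hF.combination_eq hm hmH hK hf (c := fun _ => m - 1) 0 (fun j => Nat.le_add_left _ _)
      (by omega) (fun _ _ => le_rfl) (hle γ h0 h1) (hle 1 one_pos (by omega)) (hsum γ h1).1
      (hsum 1 (by omega)).1 (hsum γ h1).2 (hsum 1 (by omega)).2 (hrel γ h1) (hrel 1 (by omega))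
  obtain ⟨h, hh⟩ : ∃ h, h = ∑ j, (![x * 1 % m, m - 1, 1] : Fin 3 → ℕ) j • f j := ⟨_, rfl⟩
  rw [← hh] at hcomb
  have hfm : ∀ i, 0 < k i → m • f i = h := by
    intro i hi
    have h1 := hle 1 one_pos (by omega)
    have := hF.combination_eq hm hmH hK hf (c := Function.update (fun _ => m - 1) i m)
      (w := Pi.single i m) (w' := ![x * 1 % m, m - 1, 1]) i
      (by
        intro j
        by_cases hj : j = i
        · subst hj
          have := Nat.mul_le_mul_right m hi
          simp only [Function.update_self]
          omega
        · simp [hj])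
      (by simp) (by intro j hj; simp [hj])
      (by
        intro j
        by_cases hj : j = i
        · subst hj; simp
        · simp [hj])
      (by
        intro j
        by_cases hj : j = i
        · subst hj
          simp only [Function.update_self]
          exact (h1 j).trans (by omega)
        · simpa [hj] using h1 j)
      (by rw [Finset.sum_pi_single' i m]; simp; omega) (hsum 1 (by omega)).1
      (by rw [Finset.sum_pi_single' i m]; simp; omega) (hsum 1 (by omega)).2
      (by
        rw [Finset.sum_eq_single i (by intro j _ hj; simp [hj]) (by simp), Pi.single_eq_same,
          hmH])
      (hrel 1 (by omega))
    rw [← hh, Finset.sum_eq_single i (by intro j _ hj; simp [hj]) (by simp),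
      Pi.single_eq_same] at this
    exact this
  have hf_map : ∀ i, π (f i) = ![u, v, w] i := by
    intro i
    refine hF.map_eq i _ ?_
    rw [hf i, Multiset.mem_replicate]
    exact ⟨by omega, rfl⟩
  have hπh : π h = 0 := by
    rw [hh, map_sum, ← hrel 1 (by omega)]
    exact Finset.sum_congr rfl fun j _ => by rw [map_nsmul, hf_map]
  have hord : addOrderOf h = n := by
    have hdvd : n • h = 0 := by
      have : Nat.card π.ker • (⟨h, hπh⟩ : π.ker) = 0 := card_nsmul_eq_zero'
      rw [hK] at this
      simpa using congrArg Subtype.val this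
    refine (addOrderOf_eq_iff hn).2 ⟨hdvd, fun l hl h0 => ?_⟩
    exact hF.nsmul_ne_zero hm hf hfm h0 hl
  refine ⟨f 0, f 1, f 2, h, k 0, k 1, k 2, x, ⟨?_, hx0, hxm, hxc, ?_, hord, hfm 0, hfm 1, hfm 2, ?_⟩,
    ?_⟩
  · rw [hf_map, hf_map, hf_map]
    exact hns
  · rw [← Fin.sum_univ_three]; exact hF.sum_eq
  · intro γ h0 h1
    have := hcomb γ h0 h1
    rwa [Fin.sum_univ_three] at this
  · rw [hSF, Fin.sum_univ_three, hf 0, hf 1, hf 2]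

end Main

/-- Assuming `C_m ⊕ C_m` has Property C, every sequence over
`G = C_m ⊕ C_{mn}` of length `2m + mn - 3 = η(G) - 1` with no short zero-sum
subsequence is of form (a) or (b). -/
theorem stmt_2 (m n : ℕ) (hm : 2 ≤ m) (hn : 0 < n)
    (hPropC : ∀ S : Multiset (ZMod m × ZMod m), S.card = 3 * m - 3 →
      (¬ ∃ U ≤ S, U ≠ 0 ∧ U.sum = 0 ∧ Multiset.card U ≤ m) →
      ∃ T : Multiset (ZMod m × ZMod m), T.card = 3 ∧ S = (m - 1) • T)
    (S : Multiset (ZMod m × ZMod (m * n)))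
    (hcard : S.card = 2 * m + m * n - 3)
    (hnoshort : ¬ ∃ T ≤ S, T ≠ 0 ∧ T.sum = 0 ∧ Multiset.card T ≤ m * n) :
    (∃ (e1 e2 : ZMod m × ZMod (m * n)) (x : ℤ) (s : ℕ),
      (∀ a b : ℤ, a • e1 + b • e2 = 0 → a • e1 = 0 ∧ b • e2 = 0) ∧
      AddSubgroup.closure ({e1, e2} : Set (ZMod m × ZMod (m * n))) = ⊤ ∧
      addOrderOf e2 = m * n ∧ Int.gcd x m = 1 ∧ 1 ≤ s ∧ s ≤ n ∧
      S = Multiset.replicate (m - 1) e1 + Multiset.replicate (s * m - 1) e2 +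
            Multiset.replicate ((n + 1 - s) * m - 1) ((-x) • e1 + e2)) ∨
    (∃ g1 g2 : ZMod m × ZMod (m * n),
      AddSubgroup.closure ({g1, g2} : Set (ZMod m × ZMod (m * n))) = ⊤ ∧
      addOrderOf g2 = m * n ∧
      S = Multiset.replicate (m - 1) g1 + Multiset.replicate (m * n - 1) g2 +
            Multiset.replicate (m - 1) (-g1 + g2)) := by

  have : NeZero m := ⟨by omega⟩
  have : NeZero (m * n) := ⟨by positivity⟩
  let ρ : ZMod (m * n) →+ ZMod m := (ZMod.castHom (dvd_mul_right m n) (ZMod m)).toAddMonoidHom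
  let π : ZMod m × ZMod (m * n) →+ ZMod m × ZMod m := (AddMonoidHom.id _).prodMap ρ
  have hsurj : Function.Surjective π :=
    Function.Surjective.prodMap Function.surjective_id (ZMod.castHom_surjective (dvd_mul_right m n))
  have hcardH : Nat.card (ZMod m × ZMod m) = m * m := by simp
  have hmH : ∀ t : ZMod m × ZMod m, m • t = 0 := fun t => by ext <;> simp
  have hK : Nat.card π.ker = n := by
    have h1 := AddSubgroup.card_eq_card_quotient_mul_card_addSubgroup π.ker
    rw [Nat.card_congr (QuotientAddGroup.quotientKerEquivOfSurjective π hsurj).toEquiv, hcardH,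
      Nat.card_prod, Nat.card_zmod, Nat.card_zmod, mul_assoc] at h1
    have hm0 : 0 < m := by omega
    exact (Nat.eq_of_mul_eq_mul_left hm0 (Nat.eq_of_mul_eq_mul_left hm0 h1)).symm
  obtain ⟨f0, f1, f2, h, k0, k1, k2, x, hf, rfl⟩ := exists_isConfig hm hn hmH hcardH hK hPropC
    hcard (fun Q hQ h0 hc hs => hnoshort ⟨Q, hQ, h0, hs, hc⟩)
  exact hf.isExtremal hmH hcardH hK
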